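/- arXiv:1705.07463 — 7 statements merged into one kernel-verified Lean document; each statement's English description precedes it below -/
import Mathlib

section
/- Let R ≥ 1 and N_T ≥ 1 be natural numbers, let η > 0, β > 0, γ > 0, δ > 0 and σ_ξ ≥ 0 be real parameters, let p_S, p_D ∈ ℝ² be fixed points (source and destination positions), and let p : Fin R → Fin N_T → ℝ² be an arbitrary deterministic collection of relay positions. Set κ := exp(−‖p_S − p_D‖₂/δ). Define the real symmetric matrix Σ of size 2·R·N_T, indexed by triples (k, a, i) ∈ Fin N_T × Fin 2 × Fin R, with entries Σ[(k,a,i),(l,b,j)] = η² · exp(−‖p(i)(k) − p(j)(l)‖₂/β) · exp(−|k − l|/γ) · (1 if a = b, and κ if a ≠ b) + σ_ξ² · (1 if (k,a,i) = (l,b,j), and 0 otherwise). Then Σ is positive semidefinite; and if σ_ξ ≠ 0, then Σ is positive definite — for every possible choice of the relay positions p. -/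
open Real

/-- Positive semidefiniteness of a real matrix through its quadratic form. -/
lemma posSemidef_iff_forall_sum_nonneg {ι : Type*} [Fintype ι] {A : Matrix ι ι ℝ} :
    A.PosSemidef ↔ (∀ i j, A i j = A j i) ∧ ∀ x : ι → ℝ, 0 ≤ ∑ i, ∑ j, x i * x j * A i j := by
  rw [Matrix.posSemidef_iff_dotProduct_mulVec]
  have key (x : ι → ℝ) : star x ⬝ᵥ A.mulVec x = ∑ i, ∑ j, x i * x j * A i j := by
    simp only [dotProduct, Matrix.mulVec, Finset.mul_sum, star_trivial]
    exact Finset.sum_congr rfl fun i _ ↦ Finset.sum_congr rfl fun j _ ↦ by ring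
  simp only [key]
  refine and_congr_left fun _ ↦ ⟨fun h i j ↦ by simpa using h.apply j i, fun h ↦ ?_⟩
  ext i j
  simpa using h j i

/-- The entrywise exponential of a positive semidefinite real matrix is positive semidefinite. -/
lemma posSemidef_exp_entries {ι : Type*} [Fintype ι] {A : Matrix ι ι ℝ} (hA : A.PosSemidef) :
    (Matrix.of fun i j ↦ exp (A i j)).PosSemidef := by
  have hpow (m : ℕ) : (Matrix.of fun i j ↦ A i j ^ m).PosSemidef := by
    induction m with
    | zero =>
      refine posSemidef_iff_forall_sum_nonneg.2 ⟨by simp, fun x ↦ ?_⟩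
      simpa [← Finset.sum_mul_sum] using mul_self_nonneg (∑ i, x i)
    | succ m ih =>
      have hmul : (Matrix.of fun i j ↦ A i j ^ (m + 1)) =
          (Matrix.of fun i j ↦ A i j ^ m).hadamard A := by
        ext i j
        simp [pow_succ]
      rw [hmul]
      exact ih.hadamard hA
  refine posSemidef_iff_forall_sum_nonneg.2 ⟨fun i j ↦ ?_, fun x ↦ ?_⟩
  · simp [(posSemidef_iff_forall_sum_nonneg.1 hA).1 i j]
  have hsum : HasSum (fun m : ℕ ↦ ∑ i, ∑ j, x i * x j * (A i j ^ m / (m.factorial : ℝ)))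
      (∑ i, ∑ j, x i * x j * exp (A i j)) := by
    refine hasSum_sum fun i _ ↦ hasSum_sum fun j _ ↦ HasSum.mul_left _ ?_
    rw [Real.exp_eq_exp_ℝ]
    exact NormedSpace.expSeries_div_hasSum_exp (A i j)
  refine hsum.nonneg fun m ↦ ?_
  have h := (posSemidef_iff_forall_sum_nonneg.1 (hpow m)).2 x
  have : ∑ i, ∑ j, x i * x j * (A i j ^ m / (m.factorial : ℝ)) =
      (∑ i, ∑ j, x i * x j * A i j ^ m) / (m.factorial : ℝ) := by
    simp only [Finset.sum_div, mul_div_assoc]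
  rw [this]
  exact div_nonneg h (by positivity)

lemma volume_real_uIoc_zero_inter (a b : ℝ) :
    MeasureTheory.volume.real (Set.uIoc 0 a ∩ Set.uIoc 0 b) = (|a| + |b| - |a - b|) / 2 := by
  rcases le_total 0 a with ha | ha <;> rcases le_total 0 b with hb | hb
  · rw [Set.uIoc_of_le ha, Set.uIoc_of_le hb, Set.Ioc_inter_Ioc, Real.volume_real_Ioc]
    grind
  · rw [Set.uIoc_of_le ha, Set.uIoc_of_ge hb, Set.Ioc_inter_Ioc, Real.volume_real_Ioc]
    grind
  · rw [Set.uIoc_of_ge ha, Set.uIoc_of_le hb, Set.Ioc_inter_Ioc, Real.volume_real_Ioc]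
    grind
  · rw [Set.uIoc_of_ge ha, Set.uIoc_of_ge hb, Set.Ioc_inter_Ioc, Real.volume_real_Ioc]
    grind

/-- The covariance kernel of two-sided Brownian motion is positive semidefinite. -/
lemma posSemidef_abs_add_abs_sub_abs {ι : Type*} [Fintype ι] (f : ι → ℝ) :
    (Matrix.of fun i j ↦ |f i| + |f j| - |f i - f j|).PosSemidef := by
  have h := MeasureTheory.posSemidef_matrix_measure_inter (μ := MeasureTheory.volume)
    (s := fun i ↦ Set.uIoc 0 (f i)) (fun _ ↦ measurableSet_uIoc)
    (fun _ ↦ by simp [Set.uIoc])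
  convert h.smul (zero_le_two (α := ℝ)) using 1
  ext i j
  simp only [Matrix.of_apply, Matrix.smul_apply, volume_real_uIoc_zero_inter, smul_eq_mul]
  ring

/-- Averaging the absolute one-dimensional projections of a planar vector over all directions
recovers its Euclidean norm up to a universal constant. -/
lemma integral_abs_projection (x : EuclideanSpace ℝ (Fin 2)) :
    ∫ θ in (0 : ℝ)..(2 * π), |x 0 * cos θ + x 1 * sin θ| =
      (∫ θ in (0 : ℝ)..(2 * π), |cos θ|) * ‖x‖ := by
  set z : ℂ := ⟨x 0, x 1⟩ with hz
  have hnorm : ‖z‖ = ‖x‖ := by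
    rw [EuclideanSpace.norm_eq, Complex.norm_eq_sqrt_sq_add_sq]
    simp [hz]
  have hproj (θ : ℝ) : |x 0 * cos θ + x 1 * sin θ| = ‖x‖ * |cos (θ - z.arg)| := by
    have h0 : x 0 = ‖x‖ * cos z.arg := by rw [← hnorm, Complex.norm_mul_cos_arg]
    have h1 : x 1 = ‖x‖ * sin z.arg := by rw [← hnorm, Complex.norm_mul_sin_arg]
    have hlin : x 0 * cos θ + x 1 * sin θ = ‖x‖ * cos (θ - z.arg) := by
      rw [cos_sub]
      linear_combination cos θ * h0 + sin θ * h1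
    rw [hlin, abs_mul, abs_norm]
  have hper : Function.Periodic (fun θ : ℝ ↦ |cos θ|) (2 * π) := fun θ ↦ by
    simp only [cos_add_two_pi]
  simp_rw [hproj]
  rw [intervalIntegral.integral_const_mul, mul_comm]
  congr 1
  rw [intervalIntegral.integral_comp_sub_right (fun θ ↦ |cos θ|)]
  have := hper.intervalIntegral_add_eq (0 - z.arg) 0
  rw [zero_add] at this
  rw [← this]
  congr 1
  ring

lemma integral_abs_cos_pos : 0 < ∫ θ in (0 : ℝ)..(2 * π), |cos θ| := by
  refine intervalIntegral.integral_pos (by positivity) (by fun_prop) (fun _ _ ↦ abs_nonneg _)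
    ⟨0, ⟨le_rfl, by positivity⟩, by simp⟩

lemma posSemidef_norm_add_norm_sub_norm {ι : Type*} [Fintype ι]
    (v : ι → EuclideanSpace ℝ (Fin 2)) :
    (Matrix.of fun i j ↦ ‖v i‖ + ‖v j‖ - ‖v i - v j‖).PosSemidef := by
  refine posSemidef_iff_forall_sum_nonneg.2 ⟨fun i j ↦ ?_, fun x ↦ ?_⟩
  · simp only [Matrix.of_apply, norm_sub_rev (v i), add_comm ‖v i‖]
  let g (y : EuclideanSpace ℝ (Fin 2)) (θ : ℝ) : ℝ := |y 0 * cos θ + y 1 * sin θ|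
  have hg (y) : IntervalIntegrable (g y) MeasureTheory.volume 0 (2 * π) :=
    Continuous.intervalIntegrable (by fun_prop) _ _
  have hint (i j : ι) : IntervalIntegrable
      (fun θ ↦ x i * x j * (g (v i) θ + g (v j) θ - g (v i - v j) θ))
      MeasureTheory.volume 0 (2 * π) :=
    (((hg _).add (hg _)).sub (hg _)).const_mul _
  have hnonneg : 0 ≤ ∫ θ in (0 : ℝ)..(2 * π),
      ∑ i, ∑ j, x i * x j * (g (v i) θ + g (v j) θ - g (v i - v j) θ) := by
    refine intervalIntegral.integral_nonneg (by positivity) fun θ _ ↦ ?_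
    have h := (posSemidef_iff_forall_sum_nonneg.1 (posSemidef_abs_add_abs_sub_abs
      fun i ↦ v i 0 * cos θ + v i 1 * sin θ)).2 x
    refine h.trans_eq (Finset.sum_congr rfl fun i _ ↦ Finset.sum_congr rfl fun j _ ↦ ?_)
    simp only [g, PiLp.sub_apply, Matrix.of_apply]
    ring_nf
  have heq : ∫ θ in (0 : ℝ)..(2 * π),
      ∑ i, ∑ j, x i * x j * (g (v i) θ + g (v j) θ - g (v i - v j) θ) =
      (∫ θ in (0 : ℝ)..(2 * π), |cos θ|) *
        ∑ i, ∑ j, x i * x j * (‖v i‖ + ‖v j‖ - ‖v i - v j‖) := by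
    rw [intervalIntegral.integral_finsetSum
      fun i _ ↦ by
        simpa only [Finset.sum_fn] using IntervalIntegrable.sum Finset.univ fun j _ ↦ hint i j]
    rw [Finset.mul_sum]
    refine Finset.sum_congr rfl fun i _ ↦ ?_
    rw [intervalIntegral.integral_finsetSum fun j _ ↦ hint i j, Finset.mul_sum]
    refine Finset.sum_congr rfl fun j _ ↦ ?_
    rw [intervalIntegral.integral_const_mul,
      intervalIntegral.integral_sub ((hg _).add (hg _)) (hg _),
      intervalIntegral.integral_add (hg _) (hg _)]
    simp only [g, integral_abs_projection]
    ring
  rw [heq] at hnonneg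
  exact nonneg_of_mul_nonneg_right hnonneg integral_abs_cos_pos

/-- The exponential kernel on the Euclidean plane is positive semidefinite. -/
lemma posSemidef_exp_neg_norm_sub_div {ι : Type*} [Fintype ι]
    (v : ι → EuclideanSpace ℝ (Fin 2)) {β : ℝ} (hβ : 0 < β) :
    (Matrix.of fun i j ↦ exp (-‖v i - v j‖ / β)).PosSemidef := by
  have h := posSemidef_exp_entries
    ((posSemidef_norm_add_norm_sub_norm v).smul (inv_nonneg.2 hβ.le))
  rw [posSemidef_iff_forall_sum_nonneg] at h
  refine posSemidef_iff_forall_sum_nonneg.2 ⟨fun i j ↦ by simp [norm_sub_rev (v i)], fun x ↦ ?_⟩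
  refine (h.2 fun i ↦ x i * exp (-‖v i‖ / β)).trans_eq
    (Finset.sum_congr rfl fun i _ ↦ Finset.sum_congr rfl fun j _ ↦ ?_)
  simp only [Matrix.of_apply, Matrix.smul_apply, smul_eq_mul]
  rw [show -‖v i - v j‖ / β =
    -‖v i‖ / β + -‖v j‖ / β + β⁻¹ * (‖v i‖ + ‖v j‖ - ‖v i - v j‖) by ring, exp_add, exp_add]
  ring

/-- Positive (semi)definiteness of the joint spatiotemporal channel covariance matrix Σ. -/
theorem stmt0 (R NT : ℕ) (hR : 1 ≤ R) (hNT : 1 ≤ NT)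
    (η β γ δ σξ : ℝ) (hη : 0 < η) (hβ : 0 < β) (hγ : 0 < γ) (hδ : 0 < δ)
    (hσξ : 0 ≤ σξ)
    (pS pD : EuclideanSpace ℝ (Fin 2))
    (p : Fin R → Fin NT → EuclideanSpace ℝ (Fin 2))
    (κ : ℝ) (hκ : κ = Real.exp (-‖pS - pD‖ / δ))
    (Sig : Matrix (Fin NT × Fin 2 × Fin R) (Fin NT × Fin 2 × Fin R) ℝ)
    (hSig : ∀ (k l : Fin NT) (a b : Fin 2) (i j : Fin R),
      Sig (k, a, i) (l, b, j) =
        η ^ 2 * Real.exp (-‖p i k - p j l‖ / β) *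
          Real.exp (-|(k : ℝ) - (l : ℝ)| / γ) * (if a = b then 1 else κ) +
        σξ ^ 2 * (if (k, a, i) = (l, b, j) then 1 else 0)) :
    Sig.PosSemidef ∧ (σξ ≠ 0 → Sig.PosDef) := by
  have hspace := posSemidef_exp_neg_norm_sub_div
    (fun s : Fin NT × Fin 2 × Fin R ↦ p s.2.2 s.1) hβ
  have htime := posSemidef_exp_neg_norm_sub_div
    (fun s : Fin NT × Fin 2 × Fin R ↦ EuclideanSpace.single (0 : Fin 2) (s.1 : ℝ)) hγ
  have hlink := posSemidef_exp_neg_norm_sub_div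
    (fun s : Fin NT × Fin 2 × Fin R ↦ if s.2.1 = 0 then pS else pD) hδ
  have hshadow := ((hspace.hadamard htime).hadamard hlink).smul (sq_nonneg η)
  obtain ⟨M, hM, rfl⟩ : ∃ M : Matrix (Fin NT × Fin 2 × Fin R) (Fin NT × Fin 2 × Fin R) ℝ,
      M.PosSemidef ∧ Sig = M + σξ ^ 2 • 1 := by
    refine ⟨_, hshadow, ?_⟩
    refine Matrix.ext fun ⟨k, a, i⟩ ⟨l, b, j⟩ ↦ (hSig k l a b i j).trans ?_
    have hsingle : ‖EuclideanSpace.single (0 : Fin 2) (k : ℝ) -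
        EuclideanSpace.single (0 : Fin 2) (l : ℝ)‖ = |(k : ℝ) - (l : ℝ)| := by
      rw [← dist_eq_norm]
      exact (PiLp.dist_single_same 2 _ _ _ _).trans (Real.dist_eq _ _)
    have hcross : exp (-‖(if a = 0 then pS else pD) - (if b = 0 then pS else pD)‖ / δ) =
        if a = b then 1 else κ := by
      fin_cases a <;> fin_cases b <;> simp [hκ, norm_sub_rev pD pS]
    rw [← hsingle, ← hcross]
    simp only [Matrix.add_apply, Matrix.smul_apply, Matrix.hadamard_apply, Matrix.one_apply,
      smul_eq_mul]
    rw [mul_assoc (η ^ 2), mul_assoc (η ^ 2)]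
    rfl
  refine ⟨hM.add (Matrix.PosSemidef.one.smul (sq_nonneg σξ)), fun hσ ↦ ?_⟩
  exact (Matrix.PosDef.one.smul (by positivity : 0 < σξ ^ 2)).posSemidef_add hM
end

section
/- Suppose: (i) there exists a P-integrable function ψ : Ω → ℝ such that |g(ω, x)| ≤ ψ(ω) for all ω ∈ Ω and all x ∈ ℝ^N; (ii) g is Carathéodory; and (iii) for every ω ∈ Ω, the map x ↦ E[g(·, x)|𝒴](ω) is continuous on ℝ^N. Then g possesses the substitution property within the class of all 𝒴-measurable maps: for every 𝒴-measurable X : Ω → ℝ^N, the function ω ↦ g(ω, X(ω)) is integrable, and for P-almost every ω ∈ Ω, E[ω' ↦ g(ω', X(ω')) | 𝒴](ω) = E[g(·, x)|𝒴](ω) evaluated at x = X(ω). In other words, the conditional expectation of g(·, X(·)) given 𝒴 is obtained by first conditioning with the second argument frozen at an arbitrary point x and then substituting x = X(ω). -/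
open MeasureTheory

section Substitution

variable {Ω E : Type*} [TopologicalSpace E]
  [TopologicalSpace.MetrizableSpace E] [SecondCountableTopology E] [MeasurableSpace E]
  [BorelSpace E] {g : Ω → E → ℝ} {ψ : Ω → ℝ} {X : Ω → E}

/-- A measurable map into a second countable metrizable space is a pointwise limit of measurable
maps with finite range. -/
theorem exists_tendsto_measurable_finite_range {m : MeasurableSpace Ω} (hX : Measurable X) :
    ∃ Z : ℕ → Ω → E, (∀ n, Measurable (Z n)) ∧ (∀ n, (Set.range (Z n)).Finite) ∧
      ∀ ω, Filter.Tendsto (fun n => Z n ω) Filter.atTop (nhds (X ω)) :=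
  ⟨fun n => hX.stronglyMeasurable.approx n, fun _ => SimpleFunc.measurable _,
    fun _ => SimpleFunc.finite_range _, hX.stronglyMeasurable.tendsto_approx⟩

/-- Composing a Carathéodory function with a measurable map gives a measurable function. -/
theorem measurable_caratheodory_comp {m : MeasurableSpace Ω}
    (hmeas : ∀ x, Measurable fun ω => g ω x)
    (hcont : ∀ ω, Continuous fun x => g ω x) (hX : Measurable X) :
    Measurable fun ω => g ω (X ω) := by
  have hg : Measurable (Function.uncurry fun x ω => g ω x) :=
    measurable_uncurry_of_continuous_of_measurable hcont hmeas
  exact hg.comp (hX.prodMk measurable_id)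

variable {m m0 : MeasurableSpace Ω} {P : Measure Ω}

/-- Composing a dominated Carathéodory function with a measurable map gives an integrable
function. -/
theorem integrable_caratheodory_comp (hψ : Integrable ψ P) (hdom : ∀ ω x, |g ω x| ≤ ψ ω)
    (hmeas : ∀ x, Measurable fun ω => g ω x) (hcont : ∀ ω, Continuous fun x => g ω x)
    (hX : Measurable X) : Integrable (fun ω => g ω (X ω)) P :=
  hψ.mono' (measurable_caratheodory_comp hmeas hcont hX).aestronglyMeasurable
    (.of_forall fun ω => hdom ω _)

/-- The substitution rule for conditional expectations at maps with finite range. -/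
theorem condExp_substitution_of_finite_range
    (hint : ∀ x, Integrable (fun ω => g ω x) P)
    (hX : Measurable[m] X) (hfin : (Set.range X).Finite)
    (hintX : Integrable (fun ω => g ω (X ω)) P) :
    ∀ᵐ ω ∂P, (P[fun ω' => g ω' (X ω') | m]) ω = (P[fun ω' => g ω' (X ω) | m]) ω := by
  have key : ∀ c ∈ Set.range X, ∀ᵐ ω ∂P, X ω = c →
      (P[fun ω' => g ω' (X ω') | m]) ω = (P[fun ω' => g ω' c | m]) ω := by
    intro c _
    have hs : MeasurableSet[m] (X ⁻¹' {c}) := hX (measurableSet_singleton c)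
    have heq : (X ⁻¹' {c}).indicator (fun ω => g ω (X ω)) =
        (X ⁻¹' {c}).indicator fun ω => g ω c :=
      Set.indicator_congr fun ω (hω : X ω = c) => by rw [hω]
    have h₁ := condExp_indicator (m := m) hintX hs
    rw [heq] at h₁
    filter_upwards [h₁, condExp_indicator (m := m) (hint c) hs] with ω h₁ h₂ hω
    have hmem : ω ∈ X ⁻¹' {c} := hω
    rw [h₁, Set.indicator_of_mem hmem, Set.indicator_of_mem hmem] at h₂
    exact h₂
  filter_upwards [(hfin.eventually_all).2 key] with ω hω
  exact hω (X ω) (Set.mem_range_self ω) rfl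

/-- The substitution rule for conditional expectations of dominated Carathéodory functions
whose conditional expectation is continuous in the parameter. -/
theorem condExp_substitution [IsFiniteMeasure P] (hm : m ≤ m0)
    (hψ : Integrable ψ P) (hdom : ∀ ω x, |g ω x| ≤ ψ ω)
    (hmeas : ∀ x, Measurable fun ω => g ω x) (hcont : ∀ ω, Continuous fun x => g ω x)
    (hcondcont : ∀ ω, Continuous fun x => (P[fun ω' => g ω' x | m]) ω)
    (hX : Measurable[m] X) :
    ∀ᵐ ω ∂P, (P[fun ω' => g ω' (X ω') | m]) ω = (P[fun ω' => g ω' (X ω) | m]) ω := by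
  have hint : ∀ {Z : Ω → E}, Measurable[m] Z → Integrable (fun ω => g ω (Z ω)) P :=
    fun hZ => integrable_caratheodory_comp hψ hdom hmeas hcont (hZ.mono hm le_rfl)
  have hintc : ∀ x, Integrable (fun ω => g ω x) P := fun x => hint measurable_const
  obtain ⟨Z, hZ, hZfin, hZlim⟩ := exists_tendsto_measurable_finite_range hX
  have hintn n : Integrable (fun ω => g ω (Z n ω)) P :=
    hint (hZ n)
  have hsimple n := condExp_substitution_of_finite_range hintc (hZ n) (hZfin n) (hintn n)
  have hcondX : StronglyMeasurable[m] fun ω => (P[fun ω' => g ω' (X ω) | m]) ω :=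
    (measurable_caratheodory_comp (fun x => stronglyMeasurable_condExp.measurable)
      hcondcont hX).stronglyMeasurable
  have hlim : ∀ᵐ ω ∂P, Filter.Tendsto
      (fun n => (P[fun ω' => g ω' (Z n ω') | m]) ω) Filter.atTop
      (nhds ((P[fun ω' => g ω' (X ω) | m]) ω)) := by
    filter_upwards [ae_all_iff.2 hsimple] with ω hω
    simp only [hω]
    exact ((hcondcont ω).tendsto (X ω)).comp (hZlim ω)
  have hbound n : ∀ᵐ ω ∂P, ‖(P[fun ω' => g ω' (Z n ω') | m]) ω‖ ≤ (P[ψ | m]) ω := by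
    have h₁ := condExp_mono (m := m) (hintn n) hψ
      (.of_forall fun ω => (abs_le.1 (hdom ω _)).2)
    have h₂ := condExp_mono (m := m) hψ.neg (hintn n)
      (.of_forall fun ω => (abs_le.1 (hdom ω _)).1)
    filter_upwards [h₁, h₂, condExp_neg ψ m] with ω h₁ h₂ h₃
    rw [h₃] at h₂
    exact abs_le.2 ⟨h₂, h₁⟩
  have hcondint : Integrable (fun ω => (P[fun ω' => g ω' (X ω) | m]) ω) P := by
    refine integrable_condExp.mono' (f := _) (g := P[ψ | m])
      (hcondX.mono hm).aestronglyMeasurable ?_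
    filter_upwards [hlim, ae_all_iff.2 hbound] with ω hω hb
    exact le_of_tendsto hω.norm (.of_forall hb)
  have h := tendsto_condExp_unique (m := m)
    (fun n ω => g ω (Z n ω)) (fun n => P[fun ω' => g ω' (Z n ω') | m])
    (fun ω => g ω (X ω)) (fun ω => (P[fun ω' => g ω' (X ω) | m]) ω)
    hintn (fun _ => integrable_condExp)
    (.of_forall fun ω => ((hcont ω).tendsto (X ω)).comp (hZlim ω)) hlim
    ψ hψ (P[ψ | m]) integrable_condExp
    (fun n => .of_forall fun ω => hdom ω _) hbound
    (fun n => (condExp_condExp_of_le le_rfl hm).symm)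
  rwa [condExp_of_stronglyMeasurable hm hcondX hcondint] at h

end Substitution

/-- Sufficient conditions for the substitution property: a dominated Carathéodory
random function whose conditional expectation is Carathéodory satisfies the
substitution rule at every `σ(Y)`-measurable random element. -/
theorem stmt3 {Ω : Type*} [m0 : MeasurableSpace Ω] (P : Measure Ω) [IsProbabilityMeasure P]
    (M N : ℕ) (Y : Ω → Fin M → ℝ) (hY : Measurable Y)
    (g : Ω → (Fin N → ℝ) → ℝ)
    (ψ : Ω → ℝ) (hψ : Integrable ψ P)
    (hdom : ∀ ω x, |g ω x| ≤ ψ ω)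
    (hmeas : ∀ x, Measurable fun ω => g ω x)
    (hcont : ∀ ω, Continuous fun x => g ω x)
    (hcondcont : ∀ ω, Continuous fun x =>
      (P[fun ω' => g ω' x | MeasurableSpace.comap Y inferInstance]) ω) :
    ∀ X : Ω → Fin N → ℝ, Measurable[MeasurableSpace.comap Y inferInstance] X →
      Integrable (fun ω => g ω (X ω)) P ∧
      ∀ᵐ ω ∂P,
        (P[fun ω' => g ω' (X ω') | MeasurableSpace.comap Y inferInstance]) ω =
        (P[fun ω' => g ω' (X ω) | MeasurableSpace.comap Y inferInstance]) ω := by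
  exact fun X hX => ⟨integrable_caratheodory_comp hψ hdom hmeas hcont (hX.mono hY.comap_le le_rfl),
    condExp_substitution hY.comap_le hψ hdom hmeas hcont hcondcont hX⟩
end

section
/- Let 𝒳 : ℝ^N → Set(ℝ^N) be a Borel measurable set-valued map with nonempty closed values, let Z : ℝ^M → ℝ^N be Borel measurable, and let g : Ω × ℝ^N → ℝ be such that g(·, x) is integrable for every x ∈ ℝ^N. Consider the decision set F of all 𝒴-measurable X : Ω → ℝ^N with X(ω) ∈ 𝒳(Z(Y(ω))) for P-a.e. ω. Assume: (a) g(·, X) := ω ↦ g(ω, X(ω)) is P-integrable for every X ∈ F; (b) the substitution rule holds at some jointly Borel h : ℝ^M × ℝ^N → ℝ, i.e., h(Y(ω), x) = E[g(·, x)|𝒴](ω) for all ω and x, and for every X ∈ F, E[g(·, X)|𝒴](ω) = h(Y(ω), X(ω)) for P-a.e. ω; and (c) the optimal value function ϑ(ω) := inf{ h(Y(ω), x) : x ∈ 𝒳(Z(Y(ω))) } is P-integrable. Then F is nonempty and the expectation and the infimum interchange: inf{ ∫ g(ω, X(ω)) dP(ω) : X ∈ F } = ∫ ϑ(ω) dP(ω).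 That is, the variational minimization over 𝒴-measurable selections of 𝒳(Z(Y)) equals the expectation of the pointwise minimization of the conditional expectation over the random constraint set. -/
open MeasureTheory

section

open Set PiNat

/-- A continuous map on the Baire space separates each value from the images of small cylinders. -/
lemma eq_of_forall_mem_closure_image_cylinder {E : Type*} [TopologicalSpace E] [T2Space E]
    {p : (ℕ → ℕ) → E} (hp : Continuous p) {x : ℕ → ℕ} {y : E}
    (hy : ∀ k, y ∈ closure (p '' cylinder x k)) : p x = y := by
  by_contra hne
  obtain ⟨U, V, hU, hV, hxU, hyV, hUV⟩ := t2_separation hne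
  obtain ⟨_, ⟨z, k, rfl⟩, hxz, hsub⟩ :=
    (isTopologicalBasis_cylinders fun _ : ℕ => ℕ).exists_subset_of_mem_open
      (show x ∈ p ⁻¹' U from hxU) (hU.preimage hp)
  obtain ⟨w, hwV, hw⟩ := mem_closure_iff.1 (hy k) V hV hyV
  obtain ⟨v, hv, rfl⟩ := hw
  rw [← mem_cylinder_iff_eq.1 hxz] at hsub
  exact hUV.le_bot ⟨hsub hv, hwV⟩

/-- The digit used to extend the finite word `τ` while staying inside the family `H`. -/
noncomputable def nextDigit {E : Type*} (H : List ℕ → Set E) (τ : List ℕ) (y : E) : ℕ :=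
  sInf {n | y ∈ H (n :: τ)}

/-- The word of length `k` obtained by greedily extending the empty word inside `H`. -/
noncomputable def greedyWord {E : Type*} (H : List ℕ → Set E) : ℕ → E → List ℕ
  | 0, _ => []
  | k + 1, y => nextDigit H (greedyWord H k y) y :: greedyWord H k y

/-- The sequence of digits obtained by greedily extending the empty word inside `H`. -/
noncomputable def greedyBranch {E : Type*} (H : List ℕ → Set E) (y : E) (k : ℕ) : ℕ :=
  nextDigit H (greedyWord H k y) y

lemma res_greedyBranch {E : Type*} (H : List ℕ → Set E) (y : E) (k : ℕ) :
    res (greedyBranch H y) k = greedyWord H k y := by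
  induction k with
  | zero => rfl
  | succ k ih => rw [res_succ, ih]; rfl

lemma mem_greedyWord {E : Type*} {H : List ℕ → Set E} {y : E} (h0 : y ∈ H [])
    (hext : ∀ τ, y ∈ H τ → ∃ n, y ∈ H (n :: τ)) (k : ℕ) : y ∈ H (greedyWord H k y) := by
  induction k with
  | zero => exact h0
  | succ k ih => exact Nat.sInf_mem (hext _ ih)

lemma measurable_nextDigit {E : Type*} [MeasurableSpace E] {H : List ℕ → Set E}
    (hH : ∀ τ, MeasurableSet (H τ)) (τ : List ℕ) : Measurable (nextDigit H τ) := by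
  refine measurable_to_countable' fun n => ?_
  have heq : nextDigit H τ ⁻¹' {n} =
      (H (n :: τ) ∩ ⋂ m < n, (H (m :: τ))ᶜ) ∪ {y | n = 0 ∧ y ∈ ⋂ m, (H (m :: τ))ᶜ} := by
    ext y
    simp only [nextDigit, mem_preimage, mem_singleton_iff, mem_union, mem_inter_iff, mem_iInter,
      mem_compl_iff, mem_ofPred_eq]
    constructor
    · rintro rfl
      by_cases hne : {n | y ∈ H (n :: τ)}.Nonempty
      · exact Or.inl ⟨Nat.sInf_mem hne, fun m hm => Nat.notMem_of_lt_sInf hm⟩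
      · rw [not_nonempty_iff_eq_empty] at hne
        refine Or.inr ⟨by rw [hne, Nat.sInf_empty], fun m hm => ?_⟩
        exact (hne ▸ (show m ∈ {n | y ∈ H (n :: τ)} from hm) : m ∈ (∅ : Set ℕ))
    · rintro (⟨h1, h2⟩ | ⟨rfl, h2⟩)
      · refine le_antisymm (Nat.sInf_le h1) (not_lt.1 fun hlt => ?_)
        exact h2 _ hlt (Nat.sInf_mem (s := {n | y ∈ H (n :: τ)}) ⟨n, h1⟩)
      · exact Nat.sInf_eq_zero.2 (Or.inr (eq_empty_of_forall_notMem h2))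
  rw [heq]
  refine ((hH _).inter (.iInter fun m => .iInter fun _ => (hH _).compl)).union ?_
  exact (MeasurableSet.const _).inter (.iInter fun m => (hH _).compl)

lemma measurableSet_greedyWord_eq {E : Type*} [MeasurableSpace E] {H : List ℕ → Set E}
    (hH : ∀ τ, MeasurableSet (H τ)) (k : ℕ) (τ : List ℕ) :
    MeasurableSet {y | greedyWord H k y = τ} := by
  induction k generalizing τ with
  | zero => exact MeasurableSet.const ([] = τ)
  | succ k ih =>
    cases τ with
    | nil => simp [greedyWord]
    | cons n τ =>
      have heq : {y | greedyWord H (k + 1) y = n :: τ} =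
          {y | greedyWord H k y = τ} ∩ nextDigit H τ ⁻¹' {n} := by
        ext y
        simp only [greedyWord, List.cons.injEq, mem_ofPred_eq, mem_inter_iff, mem_preimage,
          mem_singleton_iff]
        constructor
        · rintro ⟨h1, h2⟩
          exact ⟨h2, h2 ▸ h1⟩
        · rintro ⟨h1, h2⟩
          exact ⟨h1 ▸ h2, h1⟩
      rw [heq]
      exact (ih τ).inter (measurable_nextDigit hH τ (measurableSet_singleton n))

lemma measurable_greedyBranch {E : Type*} [MeasurableSpace E] {H : List ℕ → Set E}
    (hH : ∀ τ, MeasurableSet (H τ)) : Measurable (greedyBranch H) := by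
  refine measurable_pi_lambda _ fun k => measurable_to_countable' fun n => ?_
  have heq : (fun y => greedyBranch H y k) ⁻¹' {n} =
      ⋃ τ, {y | greedyWord H (k + 1) y = n :: τ} := by
    ext y
    simp [greedyWord, greedyBranch]
  rw [heq]
  exact .iUnion fun τ => measurableSet_greedyWord_eq hH _ _

/-- A continuous map on the Baire space has a Borel section defined almost everywhere on
its range. -/
theorem exists_measurable_section_ae {E : Type*} [TopologicalSpace E] [T2Space E]
    [MeasurableSpace E] [OpensMeasurableSpace E] (μ : Measure E) [SFinite μ]
    {p : (ℕ → ℕ) → E} (hp : Continuous p) :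
    ∃ s : E → ℕ → ℕ, Measurable s ∧ ∀ᵐ y ∂μ, y ∈ range p → p (s y) = y := by
  set C : List ℕ → Set (ℕ → ℕ) := fun τ => {x | res x τ.length = τ} with hC
  set H : List ℕ → Set E := fun τ => toMeasurable μ (p '' C τ) ∩ closure (p '' C τ) with hHdef
  have hH : ∀ τ, MeasurableSet (H τ) := fun τ =>
    (measurableSet_toMeasurable _ _).inter isClosed_closure.measurableSet
  have hsub : ∀ τ, p '' C τ ⊆ H τ := fun τ =>
    subset_inter (subset_toMeasurable _ _) subset_closure
  have hext : ∀ᵐ y ∂μ, ∀ τ, y ∈ H τ → ∃ n, y ∈ H (n :: τ) := by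
    refine ae_all_iff.2 fun τ => ?_
    have hnull : μ (toMeasurable μ (p '' C τ) ∩ (⋃ n, H (n :: τ))ᶜ) = 0 := by
      rw [Measure.measure_toMeasurable_inter_of_sFinite (MeasurableSet.iUnion fun n => hH _).compl]
      convert measure_empty (μ := μ)
      rw [← disjoint_iff_inter_eq_empty, disjoint_compl_right_iff_subset]
      rintro _ ⟨x, hx, rfl⟩
      refine mem_iUnion.2 ⟨x τ.length, hsub _ ⟨x, ?_, rfl⟩⟩
      simpa [hC] using hx
    filter_upwards [measure_eq_zero_iff_ae_notMem.1 hnull] with y hy hyH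
    by_contra hcon
    exact hy ⟨hyH.1, fun hmem => hcon (mem_iUnion.1 hmem)⟩
  refine ⟨greedyBranch H, measurable_greedyBranch hH, ?_⟩
  filter_upwards [hext] with y hy hyr
  obtain ⟨x, rfl⟩ := hyr
  refine eq_of_forall_mem_closure_image_cylinder hp fun k => ?_
  have hmem := (mem_greedyWord (hsub [] ⟨x, rfl, rfl⟩) hy k).2
  have hCk : C (greedyWord H k (p x)) = cylinder (greedyBranch H (p x)) k := by
    rw [cylinder_eq_res, ← res_greedyBranch]
    simp [hC]
  rwa [hCk] at hmem

/-- **Measurable selection** from an analytic set, almost everywhere on its projection. -/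
theorem MeasureTheory.AnalyticSet.exists_measurable_selection_ae {E G : Type*}
    [TopologicalSpace E] [T2Space E] [MeasurableSpace E] [OpensMeasurableSpace E]
    [TopologicalSpace G] [MeasurableSpace G] [BorelSpace G] [Nonempty G]
    (μ : Measure E) [SFinite μ] {B : Set (E × G)} (hB : AnalyticSet B) :
    ∃ f : E → G, Measurable f ∧ ∀ᵐ y ∂μ, (∃ x, (y, x) ∈ B) → (y, f y) ∈ B := by
  rw [AnalyticSet] at hB
  obtain rfl | ⟨φ, hφ, rfl⟩ := hB
  · inhabit G
    exact ⟨fun _ => default, measurable_const, by simp⟩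
  obtain ⟨s, hs, hsp⟩ := exists_measurable_section_ae μ (continuous_fst.comp hφ)
  refine ⟨fun y => (φ (s y)).2, (continuous_snd.comp hφ).measurable.comp hs, ?_⟩
  filter_upwards [hsp] with y hy
  rintro ⟨x, σ, hσ⟩
  exact ⟨s y, Prod.ext (hy ⟨σ, by simp [hσ]⟩) rfl⟩

/-- The graph of a closed-valued Borel measurable set-valued map is measurable. -/
lemma measurableSet_graph_of_isClosed {E G : Type*} [MeasurableSpace E] [PseudoMetricSpace G]
    [SecondCountableTopology G] [MeasurableSpace G] [OpensMeasurableSpace G] {S : E → Set G}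
    (hcl : ∀ y, IsClosed (S y))
    (hmeas : ∀ A : Set G, IsClosed A → MeasurableSet {y | (S y ∩ A).Nonempty}) :
    MeasurableSet {q : E × G | q.2 ∈ S q.1} := by
  have heq : {q : E × G | q.2 ∈ S q.1}ᶜ = ⋃ b ∈ TopologicalSpace.countableBasis G,
      {y | (S y ∩ closure b).Nonempty}ᶜ ×ˢ b := by
    ext ⟨y, x⟩
    simp only [mem_compl_iff, mem_ofPred_eq, mem_iUnion, mem_prod, exists_prop]
    constructor
    · intro hx
      obtain ⟨b, hb, hxb, hbs⟩ := (TopologicalSpace.isBasis_countableBasis G).exists_closure_subset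
        ((hcl y).isOpen_compl.mem_nhds hx)
      refine ⟨b, hb, ?_, hxb⟩
      rintro ⟨z, hz, hzb⟩
      exact hbs hzb hz
    · rintro ⟨b, -, hb, hxb⟩ hx
      exact hb ⟨x, hx, subset_closure hxb⟩
  refine MeasurableSet.of_compl ?_
  rw [heq]
  refine .biUnion (TopologicalSpace.countable_countableBasis G) fun b hb => ?_
  exact (hmeas _ isClosed_closure).compl.prod
    (TopologicalSpace.isOpen_of_mem_countableBasis hb).measurableSet

/-- Almost everywhere, a Borel integrand on a Borel graph has a Borel `ε`-optimal selection. -/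
theorem exists_measurable_almost_minimizer_ae {E G : Type*}
    [TopologicalSpace E] [PolishSpace E] [MeasurableSpace E] [BorelSpace E]
    [TopologicalSpace G] [PolishSpace G] [MeasurableSpace G] [BorelSpace G] [Nonempty G]
    (μ : Measure E) [SFinite μ] {D : Set (E × G)} (hD : MeasurableSet D)
    {h : E → G → ℝ} (hh : Measurable fun q : E × G => h q.1 q.2) {ε : ℝ} (hε : 0 < ε) :
    ∃ f : E → G, Measurable f ∧ ∀ᵐ y ∂μ, ∀ v, IsGLB (h y '' {x | (y, x) ∈ D}) v →
      (y, f y) ∈ D ∧ h y (f y) < v + ε := by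
  classical
  obtain ⟨δ, hδ0, hδε⟩ := exists_rat_btwn hε
  set B : ℚ → Set (E × G) := fun c => D ∩ {q | h q.1 q.2 < c} with hBdef
  have hB : ∀ c, MeasurableSet (B c) := fun c =>
    hD.inter (measurableSet_lt hh measurable_const)
  choose f hf hfB using fun c =>
    (hB c).analyticSet.exists_measurable_selection_ae μ
  set T : ℚ → Set E := fun c => {y | (y, f c y) ∈ B c} with hTdef
  have hT : ∀ c, MeasurableSet (T c) := fun c => (measurable_id.prodMk (hf c)) (hB c)
  obtain ⟨e, he⟩ := exists_surjective_nat ℚ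
  set Good : ℕ → Set E := fun n => T (e n) ∩ (T (e n - δ))ᶜ with hGood
  have hGoodm : ∀ n, MeasurableSet (Good n) := fun n => (hT _).inter (hT _).compl
  have hex : ∀ y, ∃ n, y ∈ Good n ∪ (⋃ m, Good m)ᶜ := by
    intro y
    by_cases hy : y ∈ ⋃ m, Good m
    · obtain ⟨n, hn⟩ := mem_iUnion.1 hy
      exact ⟨n, Or.inl hn⟩
    · exact ⟨0, Or.inr hy⟩
  have hfind : Measurable fun y => Nat.find (hex y) :=
    measurable_find hex fun n => (hGoodm n).union (MeasurableSet.iUnion hGoodm).compl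
  have hpair : Measurable fun q : ℕ × E => f (e q.1) q.2 :=
    measurable_from_prod_countable_right fun n => hf (e n)
  refine ⟨fun y => f (e (Nat.find (hex y))) y, hpair.comp (hfind.prodMk measurable_id), ?_⟩
  filter_upwards [ae_all_iff.2 hfB] with y hy v hv
  obtain ⟨c, hvc, hcv⟩ := exists_rat_btwn (lt_add_of_pos_right v hδ0)
  have hne : y ∈ ⋃ m, Good m := by
    obtain ⟨n, rfl⟩ := he c
    obtain ⟨_, ⟨x, hx, rfl⟩, -, hxc⟩ := hv.exists_between hvc
    refine mem_iUnion.2 ⟨n, hy _ ⟨x, hx, hxc⟩, fun hcon => ?_⟩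
    have h1 : v ≤ h y (f (e n - δ) y) := hv.1 ⟨_, hcon.1, rfl⟩
    have h2 : h y (f (e n - δ) y) < ((e n - δ : ℚ) : ℝ) := hcon.2
    push_cast at h2
    linarith
  obtain ⟨hT1, hT2⟩ : y ∈ Good (Nat.find (hex y)) :=
    (Nat.find_spec (hex y)).resolve_right fun hcon => hcon hne
  refine ⟨hT1.1, ?_⟩
  have h1 : h y (f (e (Nat.find (hex y))) y) < e (Nat.find (hex y)) := hT1.2
  have h2 : ((e (Nat.find (hex y)) - δ : ℚ) : ℝ) ≤ v := by
    refine hv.2 ?_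
    rintro _ ⟨x, hx, rfl⟩
    by_contra hlt
    exact hT2 (hy _ ⟨x, hx, not_le.1 hlt⟩)
  push_cast at h2
  linarith

end

/-- Fundamental Lemma of Stochastic Control (base version): the variational
minimization over `σ(Y)`-measurable selections of the random constraint set equals
the expectation of the pointwise minimization of the conditional expectation. -/
theorem stmt5 {Ω : Type*} [m0 : MeasurableSpace Ω] (P : Measure Ω) [IsProbabilityMeasure P]
    (M N : ℕ) (Y : Ω → Fin M → ℝ) (hY : Measurable Y)
    (𝒳 : (Fin N → ℝ) → Set (Fin N → ℝ))
    (h𝒳ne : ∀ y, (𝒳 y).Nonempty) (h𝒳cl : ∀ y, IsClosed (𝒳 y))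
    (h𝒳meas : ∀ A : Set (Fin N → ℝ), IsClosed A →
      MeasurableSet {y | (𝒳 y ∩ A).Nonempty})
    (Z : (Fin M → ℝ) → Fin N → ℝ) (hZ : Measurable Z)
    (g : Ω → (Fin N → ℝ) → ℝ)
    (hgint : ∀ x, Integrable (fun ω => g ω x) P)
    (F : Set (Ω → Fin N → ℝ))
    (hF : F = {X | Measurable[MeasurableSpace.comap Y inferInstance] X ∧
      ∀ᵐ ω ∂P, X ω ∈ 𝒳 (Z (Y ω))})
    (hFint : ∀ X ∈ F, Integrable (fun ω => g ω (X ω)) P)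
    (h : (Fin M → ℝ) → (Fin N → ℝ) → ℝ)
    (hhmeas : Measurable fun q : (Fin M → ℝ) × (Fin N → ℝ) => h q.1 q.2)
    (hhver : ∀ ω x, h (Y ω) x =
      (P[fun ω' => g ω' x | MeasurableSpace.comap Y inferInstance]) ω)
    (hsub : ∀ X ∈ F, ∀ᵐ ω ∂P,
      (P[fun ω' => g ω' (X ω') | MeasurableSpace.comap Y inferInstance]) ω
        = h (Y ω) (X ω))
    (ϑ : Ω → ℝ)
    (hϑ : ∀ ω, IsGLB ((fun x => h (Y ω) x) '' 𝒳 (Z (Y ω))) (ϑ ω))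
    (hϑint : Integrable ϑ P) :
    F.Nonempty ∧
    sInf ((fun X => ∫ ω, g ω (X ω) ∂P) '' F) = ∫ ω, ϑ ω ∂P := by
  have hm : MeasurableSpace.comap Y inferInstance ≤ m0 := hY.comap_le
  have hD : MeasurableSet {q : (Fin M → ℝ) × (Fin N → ℝ) | q.2 ∈ 𝒳 (Z q.1)} :=
    ((hZ.comp measurable_fst).prodMk measurable_snd)
      (measurableSet_graph_of_isClosed h𝒳cl h𝒳meas)
  have hint : ∀ X ∈ F, Integrable (fun ω => h (Y ω) (X ω)) P ∧
      ∫ ω, g ω (X ω) ∂P = ∫ ω, h (Y ω) (X ω) ∂P := fun X hX =>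
    ⟨integrable_condExp.congr (hsub X hX),
      (integral_condExp hm).symm.trans (integral_congr_ae (hsub X hX))⟩
  have hlow : ∀ X ∈ F, ∫ ω, ϑ ω ∂P ≤ ∫ ω, g ω (X ω) ∂P := by
    intro X hX
    rw [(hint X hX).2]
    refine integral_mono_ae hϑint (hint X hX).1 ?_
    have hXm := hX
    rw [hF] at hXm
    filter_upwards [hXm.2] with ω hω
    exact (hϑ ω).1 ⟨_, hω, rfl⟩
  have hup : ∀ ε : ℝ, 0 < ε → ∃ X ∈ F, ∫ ω, g ω (X ω) ∂P ≤ ∫ ω, ϑ ω ∂P + ε := by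
    intro ε hε
    obtain ⟨f, hf, hfopt⟩ := exists_measurable_almost_minimizer_ae (P.map Y) hD hhmeas hε
    have hopt : ∀ᵐ ω ∂P, f (Y ω) ∈ 𝒳 (Z (Y ω)) ∧ h (Y ω) (f (Y ω)) < ϑ ω + ε := by
      filter_upwards [ae_of_ae_map hY.aemeasurable hfopt] with ω hω
      exact hω _ (hϑ ω)
    have hX : (fun ω => f (Y ω)) ∈ F := by
      rw [hF]
      exact ⟨hf.comp (comap_measurable Y), hopt.mono fun ω hω => hω.1⟩
    refine ⟨_, hX, ?_⟩
    rw [(hint _ hX).2]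
    calc ∫ ω, h (Y ω) (f (Y ω)) ∂P ≤ ∫ ω, (ϑ ω + ε) ∂P :=
          integral_mono_ae (hint _ hX).1 (hϑint.add (integrable_const ε))
            (hopt.mono fun ω hω => hω.2.le)
      _ = ∫ ω, ϑ ω ∂P + ε := by
          rw [integral_add hϑint (integrable_const ε)]
          simp
  have hne : F.Nonempty := (hup 1 one_pos).imp fun X hX => hX.1
  refine ⟨hne, IsGLB.csInf_eq ⟨?_, fun b hb => ?_⟩ (hne.image _)⟩
  · rintro _ ⟨X, hX, rfl⟩
    exact hlow X hX
  · refine le_of_forall_pos_le_add fun ε hε => ?_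
    obtain ⟨X, hX, hle⟩ := hup ε hε
    exact (hb ⟨X, hX, rfl⟩).trans hle
end

section
/- Let P_Y denote the pushforward of P under a Borel-measurable Y : Ω → ℝ^M. Let h : ℝ^M × ℝ^N → ℝ be jointly Borel measurable, let 𝒳 : ℝ^N → Set(ℝ^N) be a Borel measurable set-valued map with nonempty closed values, and let Z : ℝ^M → ℝ^N be Borel measurable. Define the value function ξ : ℝ^M → [−∞, +∞] by ξ(y) := inf{ h(y, x) : x ∈ 𝒳(Z(y)) } (infimum in the extended reals). Then for every ε > 0 and every n ∈ ℕ there exist a Borel set O ⊆ ℝ^M with P_Y(O) = 0 and a Borel measurable map S : ℝ^M → ℝ^N such that for all y ∉ O: S(y) ∈ 𝒳(Z(y)) and h(y, S(y)) ≤ max{ ξ(y), −n } + ε. In other words, an (ε, n)-optimal Borel measurable selector of the partial minimization exists P_Y-almost everywhere. -/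
open MeasureTheory
open Set Filter Topology

/-- A set containing a box of `ℕ → ℕ` contains, if open, a box cut off at finitely many coordinates. -/
theorem exists_initial_box_subset_of_isOpen {b : ℕ → ℕ} {V : Set (ℕ → ℕ)} (hV : IsOpen V)
    (hb : {x | ∀ i, x i ≤ b i} ⊆ V) : ∃ k, {x | ∀ i < k, x i ≤ b i} ⊆ V := by
  by_contra! hcon
  simp only [not_subset] at hcon
  choose x hx hxV using hcon
  have hK : IsCompact {x : ℕ → ℕ | ∀ i, x i ≤ b i} := by
    have := isCompact_univ_pi fun i => (finite_Iic (b i)).isCompact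
    simpa [Set.pi] using this
  obtain ⟨y, hy, φ, hφ, hlim⟩ :=
    hK.tendsto_subseq (x := fun k i => min (x k i) (b i)) fun k i => min_le_right _ _
  have hlim' : Tendsto (fun k => x (φ k)) atTop (𝓝 y) := by
    rw [tendsto_pi_nhds] at hlim ⊢
    intro i
    refine (hlim i).congr' ?_
    filter_upwards [eventually_gt_atTop i] with k hk
    exact min_eq_left (hx (φ k) i (hk.trans_le hφ.le_apply))
  exact hV.isClosed_compl.mem_of_tendsto hlim' (Eventually.of_forall fun k => hxV _) (hb hy)

/-- Capacitability: the outer measure of a continuous image of `ℕ → ℕ` is approximated by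
images of compact sets. -/
theorem exists_isCompact_le_measure_image {X : Type*} [TopologicalSpace X] [MeasurableSpace X]
    (μ : Measure X) [μ.OuterRegular] {g : (ℕ → ℕ) → X} (hg : Continuous g) {c : ENNReal}
    (hc : c < μ (range g)) : ∃ K, IsCompact K ∧ c ≤ μ (g '' K) := by
  have step : ∀ (k : ℕ) (s : Set (ℕ → ℕ)), c < μ (g '' s) →
      ∃ n, c < μ (g '' (s ∩ {x | x k ≤ n})) := by
    intro k s hs
    have hmono : Monotone fun n => g '' (s ∩ {x | x k ≤ n}) := fun m n hmn =>
      image_mono (inter_subset_inter_right _ fun x hx => le_trans hx hmn)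
    have hU : ⋃ n, g '' (s ∩ {x | x k ≤ n}) = g '' s := by
      rw [← image_iUnion, ← inter_iUnion]
      congr 1
      refine inter_eq_left.2 fun x _ => mem_iUnion.2 ⟨x k, le_refl (x k)⟩
    rw [← hU, hmono.measure_iUnion] at hs
    exact lt_iSup_iff.1 hs
  choose! n hn using step
  let C : ℕ → Set (ℕ → ℕ) := fun k =>
    Nat.rec univ (fun j s => s ∩ {x | x j ≤ n j s}) k
  have hC : ∀ k, c < μ (g '' C k) := by
    intro k
    induction k with
    | zero => simpa [C] using hc
    | succ k ih => exact hn k _ ih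
  have hCsub : ∀ k, C k ⊆ {x | ∀ i < k, x i ≤ n i (C i)} := by
    intro k
    induction k with
    | zero => simp
    | succ k ih =>
      intro x hx i hi
      rcases Nat.lt_succ_iff_lt_or_eq.1 hi with h | rfl
      · exact ih hx.1 i h
      · exact hx.2
  refine ⟨{x | ∀ i, x i ≤ n i (C i)}, ?_, ?_⟩
  · have := isCompact_univ_pi fun i => (finite_Iic (n i (C i))).isCompact
    simpa [Set.pi] using this
  · rw [Set.measure_eq_iInf_isOpen]
    refine le_iInf₂ fun U hU => le_iInf fun hUo => ?_
    obtain ⟨k, hk⟩ := exists_initial_box_subset_of_isOpen (hUo.preimage hg) (image_subset_iff.1 hU)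
    exact (hC k).le.trans (measure_mono (image_subset_iff.2 ((hCsub k).trans hk)))

/-- The Baire space injects continuously into the real line. -/
theorem exists_continuous_injective_nat_nat_real :
    ∃ φ : (ℕ → ℕ) → ℝ, Continuous φ ∧ Function.Injective φ := by
  let e : (ℕ → ℕ) → ℕ → Bool := fun x k => decide (x k.unpair.1 = k.unpair.2)
  have he : Continuous e := continuous_pi fun k =>
    (continuous_of_discreteTopology (f := fun m : ℕ => decide (m = k.unpair.2))).comp
      (continuous_apply _)
  have hinj : Function.Injective e := by
    intro x y hxy
    ext i
    have := congrFun hxy (Nat.pair i (x i))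
    simpa [e, eq_comm] using this
  exact ⟨_, continuous_subtype_val.comp (cantorSetHomeomorphNatToBool.symm.continuous.comp he),
    Subtype.val_injective.comp (cantorSetHomeomorphNatToBool.symm.injective.comp hinj)⟩

/-- A continuous map has a Borel section over the image of a compact subset of `ℕ → ℕ`. -/
theorem IsCompact.exists_measurable_section {X : Type*} [TopologicalSpace X] [T2Space X]
    [MeasurableSpace X] [OpensMeasurableSpace X] {g : (ℕ → ℕ) → X} (hg : Continuous g)
    {K : Set (ℕ → ℕ)} (hK : IsCompact K) :
    ∃ s : X → ℕ → ℕ, Measurable s ∧ ∀ y ∈ g '' K, g (s y) = y := by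
  classical
  obtain ⟨φ, hφ, hinj⟩ := exists_continuous_injective_nat_nat_real
  have hemb : MeasurableEmbedding φ := hφ.measurableEmbedding hinj
  let t : X → ℝ := (g '' K).piecewise (fun y => sInf (φ '' (K ∩ g ⁻¹' {y}))) 0
  have hattain : ∀ y ∈ g '' K, IsLeast (φ '' (K ∩ g ⁻¹' {y})) (t y) := by
    rintro y ⟨x, hxK, rfl⟩
    rw [show t (g x) = _ from piecewise_eq_of_mem _ _ _ (mem_image_of_mem g hxK)]
    exact ((hK.inter_right (isClosed_singleton.preimage hg)).image hφ).isLeast_sInf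
      ⟨_, mem_image_of_mem φ ⟨hxK, rfl⟩⟩
  have hmeas : MeasurableSet (g '' K) := (hK.image hg).measurableSet
  have ht : Measurable t := by
    refine measurable_of_Iic fun c => ?_
    have : t ⁻¹' Iic c = g '' (K ∩ φ ⁻¹' Iic c) ∪ ((g '' K)ᶜ ∩ {_y | (0 : ℝ) ≤ c}) := by
      ext y
      by_cases hy : y ∈ g '' K
      · simp only [mem_preimage, mem_union, mem_inter_iff, mem_compl_iff, hy, not_true, false_and,
          or_false]
        constructor
        · intro hc
          obtain ⟨x, ⟨hxK, hxy⟩, hx⟩ := (hattain y hy).1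
          exact ⟨x, ⟨hxK, by simpa [hx] using hc⟩, hxy⟩
        · rintro ⟨x, ⟨hxK, hxc⟩, rfl⟩
          exact ((hattain _ hy).2 ⟨x, ⟨hxK, rfl⟩, rfl⟩).trans hxc
      · have h1 : t y = 0 := piecewise_eq_of_notMem _ _ _ hy
        have h2 : y ∉ g '' (K ∩ φ ⁻¹' Iic c) := fun h => hy (image_mono inter_subset_left h)
        simp only [mem_preimage, h1, mem_union, h2, mem_inter_iff, mem_compl_iff, hy]
        simp
    rw [this]
    exact (((hK.inter_right (isClosed_Iic.preimage hφ)).image hg).measurableSet).union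
      (hmeas.compl.inter (MeasurableSet.const _))
  refine ⟨hemb.invFun ∘ t, hemb.measurable_invFun.comp ht, fun y hy => ?_⟩
  obtain ⟨x, ⟨-, hxy⟩, hx⟩ := (hattain y hy).1
  rw [Function.comp_apply, ← hx, hemb.leftInverse_invFun x]
  exact hxy

/-- Gluing of countably many partial measurable maps, with priority to the first one defined. -/
theorem exists_measurable_eq_first {X W : Type*} [MeasurableSpace X] [MeasurableSpace W]
    {D : ℕ → Set X} (hD : ∀ k, MeasurableSet (D k)) {S : ℕ → X → W} (hS : ∀ k, Measurable (S k)) :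
    ∃ T : X → W, Measurable T ∧
      ∀ y ∈ ⋃ k, D k, ∃ k, y ∈ D k ∧ (∀ j < k, y ∉ D j) ∧ T y = S k y := by
  classical
  have hp : ∀ y, ∃ k, y ∈ D k ∨ y ∉ ⋃ k, D k := fun y => by
    by_cases hy : y ∈ ⋃ k, D k
    · exact (mem_iUnion.1 hy).imp fun k => Or.inl
    · exact ⟨0, Or.inr hy⟩
  refine ⟨fun y => S (Nat.find (hp y)) y, Measurable.find hS
    (p := fun k y => y ∈ D k ∨ y ∉ ⋃ k, D k)
    (fun k => (hD k).union (MeasurableSet.iUnion hD).compl) hp, fun y hy => ?_⟩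
  exact ⟨Nat.find (hp y), (Nat.find_spec (hp y)).resolve_right (not_not_intro hy),
    fun j hj hyj => Nat.find_min (hp y) hj (Or.inl hyj), rfl⟩

/-- Almost everywhere form of the Jankov–von Neumann selection theorem. -/
theorem MeasurableSet.exists_measurable_ae_selector {X W : Type*}
    [TopologicalSpace X] [PolishSpace X] [MeasurableSpace X] [BorelSpace X]
    [TopologicalSpace W] [PolishSpace W] [MeasurableSpace W] [BorelSpace W] [Nonempty W]
    (μ : Measure X) [IsFiniteMeasure μ] {B : Set (X × W)} (hB : MeasurableSet B) :
    ∃ D : Set X, MeasurableSet D ∧ μ (Prod.fst '' B \ D) = 0 ∧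
      ∃ S : X → W, Measurable S ∧ ∀ y ∈ D, (y, S y) ∈ B := by
  have han : AnalyticSet B := hB.analyticSet
  rw [AnalyticSet] at han
  rcases han with rfl | ⟨f, hf, rfl⟩
  · exact ⟨∅, MeasurableSet.empty, by simp, fun _ => Classical.arbitrary W, measurable_const,
      by simp⟩
  set g : (ℕ → ℕ) → X := fun x => (f x).1
  have hg : Continuous g := continuous_fst.comp hf
  have hrange : Prod.fst '' range f = range g := (range_comp Prod.fst f).symm
  rw [hrange]
  rcases eq_or_ne (μ (range g)) 0 with h0 | h0
  · exact ⟨∅, MeasurableSet.empty, by simpa using h0, fun _ => Classical.arbitrary W,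
      measurable_const, by simp⟩
  obtain ⟨c, -, hclt, hclim⟩ := exists_seq_strictMono_tendsto' (pos_iff_ne_zero.2 h0)
  choose K hK hcK using fun k => exists_isCompact_le_measure_image μ hg (hclt k).2
  choose s hs hsg using fun k => (hK k).exists_measurable_section hg
  have hD : ∀ k, MeasurableSet (g '' K k) := fun k => ((hK k).image hg).measurableSet
  obtain ⟨T, hT, hTs⟩ := exists_measurable_eq_first hD hs
  refine ⟨⋃ k, g '' K k, MeasurableSet.iUnion hD, ?_, fun y => (f (T y)).2,
    (hf.measurable.comp hT).snd, fun y hy => ⟨T y, ?_⟩⟩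
  · have hsub : ⋃ k, g '' K k ⊆ range g := iUnion_subset fun k => image_subset_range _ _
    rw [measure_sdiff hsub (MeasurableSet.iUnion hD).nullMeasurableSet (measure_ne_top _ _),
      tsub_eq_zero_iff_le]
    exact le_of_tendsto' hclim fun k => (hcK k).trans (measure_mono (subset_iUnion (fun k => g '' K k) k))
  · obtain ⟨k, hyk, -, hTk⟩ := hTs y hy
    have : g (T y) = y := hTk ▸ hsg k y hyk
    exact Prod.ext this rfl

/-- The graph of a measurable closed-valued map is measurable. -/
theorem measurableSet_graph_of_isClosed_s6 {Z W : Type*} [MeasurableSpace Z]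
    [TopologicalSpace W] [RegularSpace W] [SecondCountableTopology W] [MeasurableSpace W]
    [OpensMeasurableSpace W] {F : Z → Set W} (hcl : ∀ z, IsClosed (F z))
    (hmeas : ∀ A, IsClosed A → MeasurableSet {z | (F z ∩ A).Nonempty}) :
    MeasurableSet {p : Z × W | p.2 ∈ F p.1} := by
  have hb := TopologicalSpace.isBasis_countableBasis W
  have : {p : Z × W | p.2 ∈ F p.1}ᶜ = ⋃ u ∈ TopologicalSpace.countableBasis W,
      {z | (F z ∩ closure u).Nonempty}ᶜ ×ˢ closure u := by
    ext ⟨z, w⟩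
    simp only [mem_compl_iff, mem_ofPred_eq, mem_iUnion, mem_prod, exists_prop]
    constructor
    · intro hw
      obtain ⟨u, hu, hwu, hsub⟩ := hb.exists_closure_subset ((hcl z).isOpen_compl.mem_nhds hw)
      exact ⟨u, hu, fun ⟨v, hv, hvu⟩ => hsub hvu hv, subset_closure hwu⟩
    · rintro ⟨u, -, hne, hwu⟩ hw
      exact hne ⟨w, hw, hwu⟩
  refine MeasurableSet.of_compl ?_
  rw [this]
  exact MeasurableSet.biUnion (TopologicalSpace.countable_countableBasis W) fun u _ =>
    (hmeas _ isClosed_closure).compl.prod isClosed_closure.measurableSet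

/-- Existence of an (ε, n)-optimal Borel measurable selector of the partial
minimization, `P_Y`-almost everywhere (Step 7 of the Fundamental Lemma). -/
theorem stmt6 {Ω : Type*} [MeasurableSpace Ω] (P : Measure Ω) [IsProbabilityMeasure P]
    (M N : ℕ) (Y : Ω → Fin M → ℝ) (hY : Measurable Y)
    (h : (Fin M → ℝ) → (Fin N → ℝ) → ℝ)
    (hh : Measurable fun q : (Fin M → ℝ) × (Fin N → ℝ) => h q.1 q.2)
    (𝒳 : (Fin N → ℝ) → Set (Fin N → ℝ))
    (h𝒳ne : ∀ y, (𝒳 y).Nonempty) (h𝒳cl : ∀ y, IsClosed (𝒳 y))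
    (h𝒳meas : ∀ A : Set (Fin N → ℝ), IsClosed A →
      MeasurableSet {y | (𝒳 y ∩ A).Nonempty})
    (Z : (Fin M → ℝ) → Fin N → ℝ) (hZ : Measurable Z)
    (ξ : (Fin M → ℝ) → EReal)
    (hξ : ∀ y, ξ y = ⨅ x ∈ 𝒳 (Z y), ((h y x : ℝ) : EReal)) :
    ∀ ε : ℝ, 0 < ε → ∀ n : ℕ,
      ∃ O : Set (Fin M → ℝ), MeasurableSet O ∧ P.map Y O = 0 ∧
        ∃ S : (Fin M → ℝ) → Fin N → ℝ, Measurable S ∧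
          ∀ y ∉ O, S y ∈ 𝒳 (Z y) ∧
            ((h y (S y) : ℝ) : EReal) ≤ max (ξ y) ((-(n : ℝ) : ℝ) : EReal) + ((ε : ℝ) : EReal) := by
  intro ε hε n
  let B : ℕ → Set ((Fin M → ℝ) × (Fin N → ℝ)) := fun k =>
    {p | p.2 ∈ 𝒳 (Z p.1)} ∩ {p | h p.1 p.2 < -n + k * ε}
  have hgraph : MeasurableSet {p : (Fin M → ℝ) × (Fin N → ℝ) | p.2 ∈ 𝒳 (Z p.1)} :=
    (measurableSet_graph_of_isClosed_s6 h𝒳cl h𝒳meas).preimage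
      ((hZ.comp measurable_fst).prodMk measurable_snd)
  have hB : ∀ k, MeasurableSet (B k) := fun k => hgraph.inter (hh measurableSet_Iio)
  have := Measure.isProbabilityMeasure_map (μ := P) hY.aemeasurable
  choose D hD hD0 S hS hSB using fun k => (hB k).exists_measurable_ae_selector (P.map Y)
  obtain ⟨T, hT, hTS⟩ := exists_measurable_eq_first hD hS
  have hnull : P.map Y (⋃ k, Prod.fst '' B k \ D k) = 0 := measure_iUnion_null hD0
  refine ⟨toMeasurable (P.map Y) (⋃ k, Prod.fst '' B k \ D k), measurableSet_toMeasurable _ _,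
    by rwa [measure_toMeasurable], T, hT, fun y hy => ?_⟩
  have hyD : ∀ (k : ℕ) x, x ∈ 𝒳 (Z y) → h y x < -n + k * ε → y ∈ D k := by
    intro k x hx hlt
    by_contra hk
    exact hy (subset_toMeasurable _ _ (mem_iUnion.2 ⟨k, ⟨(y, x), ⟨hx, hlt⟩, rfl⟩, hk⟩))
  obtain ⟨x₀, hx₀⟩ := h𝒳ne (Z y)
  obtain ⟨k₀, hk₀⟩ := exists_nat_gt ((h y x₀ + n) / ε)
  rw [div_lt_iff₀ hε] at hk₀
  obtain ⟨k, hyk, hmin, hTk⟩ := hTS y (mem_iUnion.2 ⟨k₀, hyD k₀ x₀ hx₀ (by linarith)⟩)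
  obtain ⟨hmem, hlt⟩ : S k y ∈ 𝒳 (Z y) ∧ h y (S k y) < -n + k * ε := hSB k y hyk
  rw [hTk]
  refine ⟨hmem, ?_⟩
  rcases k with _ | k
  · calc ((h y (S 0 y) : ℝ) : EReal) ≤ ((-(n : ℝ) : ℝ) : EReal) + (ε : EReal) := by
          rw [← EReal.coe_add, EReal.coe_le_coe_iff]
          push_cast at hlt
          linarith
      _ ≤ _ := by gcongr; exact le_max_right _ _
  · have hlow : ((-n + k * ε : ℝ) : EReal) ≤ ξ y := by
      rw [hξ]
      refine le_iInf₂ fun x hx => EReal.coe_le_coe_iff.2 (le_of_not_gt fun hx' => ?_)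
      exact hmin k k.lt_succ_self (hyD k x hx hx')
    calc ((h y (S (k + 1) y) : ℝ) : EReal) ≤ ((-n + k * ε : ℝ) : EReal) + (ε : EReal) := by
          rw [← EReal.coe_add, EReal.coe_le_coe_iff]
          push_cast at hlt
          linarith
      _ ≤ _ := by gcongr; exact hlow.trans (le_max_left _ _)
end

section
/- Let (Ω, 𝒴) be a measurable space, let H : Ω × ℝ^N → ℝ be such that H(·, x) is 𝒴-measurable for every x ∈ ℝ^N and H(ω, ·) is continuous on ℝ^N for every ω ∈ Ω, let Z : Ω → ℝ^N be 𝒴-measurable, and let 𝒳 : ℝ^N → Set(ℝ^N) be a set-valued map with nonempty compact values that is closed (i.e., for all convergent sequences x_k → x and y_k → y in ℝ^N with x_k ∈ 𝒳(y_k) for all k, one has x ∈ 𝒳(y)). Then: (i) the optimal value function H*(ω) := inf{ H(ω, x) : x ∈ 𝒳(Z(ω)) } is 𝒴-measurable; and (ii) the infimum is attained by at least one 𝒴-measurable minimizer, i.e., there exists a 𝒴-measurable X* : Ω → ℝ^N such that for every ω ∈ Ω, X*(ω) ∈ 𝒳(Z(ω)) and H(ω, X*(ω)) = H*(ω). Consequently,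 if the minimizer is unique for every ω, it is 𝒴-measurable. -/
open MeasureTheory Filter

/-- A set-valued map with nonempty compact values such that the preimage of every closed set
(the set of points whose value meets it) is measurable. -/
structure IsMeasurableCompactMultifunction {Ω X : Type*} [MeasurableSpace Ω] [TopologicalSpace X]
    (A : Ω → Set X) : Prop where
  nonempty : ∀ ω, (A ω).Nonempty
  isCompact : ∀ ω, IsCompact (A ω)
  measurableSet_inter_nonempty : ∀ F : Set X, IsClosed F → MeasurableSet {ω | (A ω ∩ F).Nonempty}

namespace IsMeasurableCompactMultifunction

section Minimization

variable {Ω X : Type*} [MeasurableSpace Ω] [PseudoMetricSpace X]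
  {A : Ω → Set X} {f : Ω → X → ℝ}

/-- A point of the compact set `K` where `g ≤ c` exists iff `K` comes arbitrarily close to points
of a dense sequence where `g` is almost at most `c`. -/
theorem _root_.IsCompact.exists_le_iff_forall_exists_denseSeq [TopologicalSpace.SeparableSpace X]
    [Nonempty X] {K : Set X} (hK : IsCompact K) {g : X → ℝ} (hg : Continuous g) (c : ℝ) :
    (∃ x ∈ K, g x ≤ c) ↔ ∀ n : ℕ, ∃ i : ℕ,
      g (TopologicalSpace.denseSeq X i) < c + 1 / ((n : ℝ) + 1) ∧
      (K ∩ Metric.closedBall (TopologicalSpace.denseSeq X i) (1 / ((n : ℝ) + 1))).Nonempty := by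
  constructor
  · rintro ⟨x, hxK, hx⟩ n
    have hn : (0 : ℝ) < 1 / ((n : ℝ) + 1) := Nat.one_div_pos_of_nat
    have hopen : IsOpen (g ⁻¹' Set.Iio (c + 1 / ((n : ℝ) + 1)) ∩
        Metric.ball x (1 / ((n : ℝ) + 1))) :=
      (isOpen_Iio.preimage hg).inter Metric.isOpen_ball
    have hmem : x ∈ g ⁻¹' Set.Iio (c + 1 / ((n : ℝ) + 1)) ∩
        Metric.ball x (1 / ((n : ℝ) + 1)) :=
      ⟨show g x < _ by linarith, Metric.mem_ball_self hn⟩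
    obtain ⟨i, hi⟩ := (TopologicalSpace.denseRange_denseSeq X).exists_mem_open hopen ⟨x, hmem⟩
    exact ⟨i, hi.1, x, hxK, Metric.mem_closedBall'.2 (Metric.mem_ball.1 hi.2).le⟩
  · intro h
    choose i hi x hxK hx using h
    obtain ⟨a, haK, φ, hφ, hlim⟩ := hK.tendsto_subseq hxK
    have hz : Tendsto (fun n => 1 / ((φ n : ℝ) + 1)) atTop (nhds 0) :=
      tendsto_one_div_add_atTop_nhds_zero_nat.comp hφ.tendsto_atTop
    have hd : Tendsto (fun n => TopologicalSpace.denseSeq X (i (φ n))) atTop (nhds a) :=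
      hlim.congr_dist (squeeze_zero (fun _ => dist_nonneg)
        (fun n => Metric.mem_closedBall.1 (hx (φ n))) hz)
    refine ⟨a, haK, le_of_tendsto_of_tendsto ((hg.tendsto a).comp hd)
      (by simpa using hz.const_add c) (Eventually.of_forall fun n => (hi (φ n)).le)⟩

theorem measurableSet_exists_le [TopologicalSpace.SeparableSpace X]
    (hA : IsMeasurableCompactMultifunction A)
    (hfm : ∀ x, Measurable fun ω => f ω x) (hfc : ∀ ω, Continuous (f ω))
    {F : Set X} (hF : IsClosed F) {c : Ω → ℝ} (hc : Measurable c) :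
    MeasurableSet {ω | ∃ x ∈ A ω ∩ F, f ω x ≤ c ω} := by
  rcases isEmpty_or_nonempty X with hX | hX
  · simp
  have key : {ω | ∃ x ∈ A ω ∩ F, f ω x ≤ c ω} = ⋂ n : ℕ, ⋃ i : ℕ,
      {ω | f ω (TopologicalSpace.denseSeq X i) < c ω + 1 / ((n : ℝ) + 1)} ∩
      {ω | (A ω ∩ (F ∩ Metric.closedBall (TopologicalSpace.denseSeq X i)
        (1 / ((n : ℝ) + 1)))).Nonempty} := by
    ext ω
    simp only [Set.mem_iInter, Set.mem_iUnion, ← Set.inter_assoc]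
    exact ((hA.isCompact ω).inter_right hF).exists_le_iff_forall_exists_denseSeq (hfc ω) (c ω)
  rw [key]
  exact .iInter fun n => .iUnion fun i =>
    (measurableSet_lt (hfm _) (hc.add_const _)).inter
      (hA.measurableSet_inter_nonempty _ (hF.inter Metric.isClosed_closedBall))

theorem measurable_of_isLeast [TopologicalSpace.SeparableSpace X]
    (hA : IsMeasurableCompactMultifunction A)
    (hfm : ∀ x, Measurable fun ω => f ω x) (hfc : ∀ ω, Continuous (f ω))
    {m : Ω → ℝ} (hm : ∀ ω, IsLeast (f ω '' A ω) (m ω)) : Measurable m := by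
  refine measurable_of_Iic fun c => ?_
  convert hA.measurableSet_exists_le hfm hfc isClosed_univ (measurable_const (a := c)) using 1
  ext ω
  simp only [Set.mem_preimage, Set.mem_Iic, Set.inter_univ, Set.mem_ofPred_eq]
  constructor
  · intro h
    obtain ⟨x, hx, hxm⟩ := (hm ω).1
    exact ⟨x, hx, hxm.trans_le h⟩
  · rintro ⟨x, hx, hxc⟩
    exact ((hm ω).2 ⟨x, hx, rfl⟩).trans hxc

/-- The set of minimizers of a Carathéodory function over a measurable compact multifunction is
again a measurable compact multifunction. -/
theorem argmin [TopologicalSpace.SeparableSpace X]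
    (hA : IsMeasurableCompactMultifunction A)
    (hfm : ∀ x, Measurable fun ω => f ω x) (hfc : ∀ ω, Continuous (f ω))
    {m : Ω → ℝ} (hm : ∀ ω, IsLeast (f ω '' A ω) (m ω)) :
    IsMeasurableCompactMultifunction fun ω => {x ∈ A ω | f ω x = m ω} where
  nonempty ω := (hm ω).1
  isCompact ω := (hA.isCompact ω).inter_right (isClosed_eq (hfc ω) continuous_const)
  measurableSet_inter_nonempty F hF := by
    convert hA.measurableSet_exists_le hfm hfc hF (hA.measurable_of_isLeast hfm hfc hm) using 1
    ext ω
    constructor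
    · rintro ⟨x, ⟨hxA, hx⟩, hxF⟩
      exact ⟨x, ⟨hxA, hxF⟩, hx.le⟩
    · rintro ⟨x, ⟨hxA, hxF⟩, hx⟩
      exact ⟨x, ⟨hxA, hx.antisymm ((hm ω).2 ⟨x, hxA, rfl⟩)⟩, hxF⟩

theorem isLeast_sInf_image (hA : IsMeasurableCompactMultifunction A)
    (hfc : ∀ ω, Continuous (f ω)) (ω : Ω) : IsLeast (f ω '' A ω) (sInf (f ω '' A ω)) :=
  ((hA.isCompact ω).image (hfc ω)).isLeast_sInf ((hA.nonempty ω).image _)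

end Minimization

variable {Ω : Type*} [MeasurableSpace Ω]

theorem exists_subset_forall_mem_eq {ι : Type*} [Fintype ι] {A : Ω → Set (ι → ℝ)}
    (hA : IsMeasurableCompactMultifunction A) (s : Finset ι) :
    ∃ B : Ω → Set (ι → ℝ), IsMeasurableCompactMultifunction B ∧ (∀ ω, B ω ⊆ A ω) ∧
      ∀ ω, ∀ x ∈ B ω, ∀ y ∈ B ω, ∀ i ∈ s, x i = y i := by
  classical
  induction s using Finset.induction_on with
  | empty => exact ⟨A, hA, fun _ => subset_rfl, by simp⟩
  | insert i s _ ih =>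
    obtain ⟨B, hB, hBA, hBs⟩ := ih
    have hc : ∀ _ : Ω, Continuous fun x : ι → ℝ => x i := fun _ => continuous_apply i
    refine ⟨_, hB.argmin (f := fun _ x => x i) (fun _ => measurable_const) hc
      (hB.isLeast_sInf_image hc),
      fun ω x hx => hBA ω hx.1, fun ω x hx y hy j hj => ?_⟩
    rcases Finset.mem_insert.1 hj with rfl | hj
    · exact hx.2.trans hy.2.symm
    · exact hBs ω x hx.1 y hy.1 j hj

theorem exists_measurable_selection {ι : Type*} [Fintype ι] {A : Ω → Set (ι → ℝ)}
    (hA : IsMeasurableCompactMultifunction A) :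
    ∃ g : Ω → ι → ℝ, Measurable g ∧ ∀ ω, g ω ∈ A ω := by
  obtain ⟨B, hB, hBA, hBs⟩ := hA.exists_subset_forall_mem_eq Finset.univ
  choose g hg using hB.nonempty
  refine ⟨g, measurable_of_isClosed fun F hF => ?_, fun ω => hBA ω (hg ω)⟩
  convert hB.measurableSet_inter_nonempty F hF using 1
  ext ω
  constructor
  · exact fun h => ⟨g ω, hg ω, h⟩
  · rintro ⟨x, hx, hxF⟩
    have hxg : x = g ω := funext fun i => hBs ω x hx _ (hg ω) i (Finset.mem_univ i)
    exact Set.mem_preimage.2 (hxg ▸ hxF)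

/-- A multifunction with nonempty compact values and sequentially closed graph, composed with a
measurable map, is measurable. -/
theorem of_closed_graph {X Y : Type*} [PseudoMetricSpace X] [ProperSpace X]
    [TopologicalSpace Y] [SequentialSpace Y] [MeasurableSpace Y] [OpensMeasurableSpace Y]
    {G : Y → Set X} (hne : ∀ y, (G y).Nonempty) (hcp : ∀ y, IsCompact (G y))
    (hcl : ∀ (xs : ℕ → X) (ys : ℕ → Y) (x : X) (y : Y),
      Tendsto xs atTop (nhds x) → Tendsto ys atTop (nhds y) →
      (∀ k, xs k ∈ G (ys k)) → x ∈ G y)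
    {Z : Ω → Y} (hZ : Measurable Z) :
    IsMeasurableCompactMultifunction fun ω => G (Z ω) where
  nonempty ω := hne _
  isCompact ω := hcp _
  measurableSet_inter_nonempty F hF := by
    rcases isEmpty_or_nonempty X with hX | ⟨⟨a⟩⟩
    · simp [Set.Nonempty]
    have hclosed : ∀ K : Set X, IsCompact K → IsClosed {y | (G y ∩ K).Nonempty} := by
      refine fun K hK => IsSeqClosed.isClosed fun ys y hys hy => ?_
      choose xs hxs hxsK using hys
      obtain ⟨x, hxK, φ, hφ, hx⟩ := hK.tendsto_subseq hxsK
      exact ⟨x, hcl _ _ x y hx (hy.comp hφ.tendsto_atTop) fun k => hxs (φ k), hxK⟩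
    have key : {ω | (G (Z ω) ∩ F).Nonempty} =
        ⋃ n : ℕ, Z ⁻¹' {y | (G y ∩ (F ∩ Metric.closedBall a n)).Nonempty} := by
      ext ω
      simp only [Set.mem_ofPred_eq, Set.mem_iUnion, Set.mem_preimage]
      constructor
      · rintro ⟨x, hx, hxF⟩
        obtain ⟨n, hn⟩ := exists_nat_ge (dist x a)
        exact ⟨n, x, hx, hxF, hn⟩
      · rintro ⟨n, x, hx, hxF, _⟩
        exact ⟨x, hx, hxF⟩
    rw [key]
    exact .iUnion fun n =>
      hZ (hclosed _ ((isCompact_closedBall a n).inter_left hF)).measurableSet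

end IsMeasurableCompactMultifunction

/-- Measurability under partial minimization: a Carathéodory function minimized
over a closed compact-valued multifunction composed with a measurable map has a
measurable optimal value and at least one measurable minimizer; a unique
minimizer is necessarily measurable. -/
theorem stmt7 {Ω : Type*} [MeasurableSpace Ω]
    (N : ℕ) (H : Ω → (Fin N → ℝ) → ℝ)
    (hHmeas : ∀ x, Measurable fun ω => H ω x)
    (hHcont : ∀ ω, Continuous fun x => H ω x)
    (Z : Ω → Fin N → ℝ) (hZ : Measurable Z)
    (𝒳 : (Fin N → ℝ) → Set (Fin N → ℝ))
    (h𝒳ne : ∀ y, (𝒳 y).Nonempty) (h𝒳cp : ∀ y, IsCompact (𝒳 y))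
    (h𝒳closed : ∀ (xs ys : ℕ → Fin N → ℝ) (x y : Fin N → ℝ),
      Tendsto xs atTop (nhds x) → Tendsto ys atTop (nhds y) →
      (∀ k, xs k ∈ 𝒳 (ys k)) → x ∈ 𝒳 y)
    (Hstar : Ω → ℝ)
    (hHstar : ∀ ω, Hstar ω = sInf ((fun x => H ω x) '' 𝒳 (Z ω))) :
    Measurable Hstar ∧
    (∃ Xstar : Ω → Fin N → ℝ, Measurable Xstar ∧
      ∀ ω, Xstar ω ∈ 𝒳 (Z ω) ∧ H ω (Xstar ω) = Hstar ω) ∧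
    (∀ X' : Ω → Fin N → ℝ,
      (∀ ω, X' ω ∈ 𝒳 (Z ω) ∧ H ω (X' ω) = Hstar ω ∧
        ∀ x ∈ 𝒳 (Z ω), H ω x = Hstar ω → x = X' ω) → Measurable X') := by
  obtain rfl : Hstar = fun ω => sInf ((fun x => H ω x) '' 𝒳 (Z ω)) := funext hHstar
  have hA := IsMeasurableCompactMultifunction.of_closed_graph h𝒳ne h𝒳cp h𝒳closed hZ
  have hleast := hA.isLeast_sInf_image hHcont
  obtain ⟨Xstar, hXm, hX⟩ := (hA.argmin hHmeas hHcont hleast).exists_measurable_selection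
  refine ⟨hA.measurable_of_isLeast hHmeas hHcont hleast, ⟨Xstar, hXm, hX⟩, fun X' hX' => ?_⟩
  obtain rfl : Xstar = X' := funext fun ω => (hX' ω).2.2 _ (hX ω).1 (hX ω).2
  exact hXm
end

section
/- Suppose: (C1) 𝒳 : ℝ^N → Set(ℝ^N) is a closed set-valued map with nonempty compact values; (C2) Z : ℝ^M → ℝ^N is Borel measurable, so that Z_Y := Z ∘ Y is 𝒴-measurable; let F be the decision set of all 𝒴-measurable X : Ω → ℝ^N with X(ω) ∈ 𝒳(Z_Y(ω)) for P-a.e. ω; (C3) ω ↦ g(ω, X(ω)) is P-integrable for every X ∈ F; (C4) there exists a P-integrable ψ with |g(ω, x)| ≤ ψ(ω) for all ω and x; (C5) g is Carathéodory; and (C6) for every ω, the map x ↦ E[g(·, x)|𝒴](ω) is continuous on ℝ^N. Then there exists a 𝒴-measurable X* : Ω → ℝ^N such that: X*(ω) ∈ 𝒳(Z_Y(ω)) for every ω; for every ω and every x ∈ 𝒳(Z_Y(ω)), E[g(·, X*(ω))|𝒴](ω) ≤ E[g(·, x)|𝒴](ω) (i.e., X*(ω) pointwise minimizes the conditional expectation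 over the random constraint set); and ∫ g(ω, X*(ω)) dP(ω) ≤ ∫ g(ω, X(ω)) dP(ω) for every X ∈ F, so that X* attains the infimum of the variational problem inf_{X ∈ F} E[g(·, X)]. -/
open MeasureTheory

section MeasurableSelection

variable {α E : Type*} [MeasurableSpace α]

/-- A set-valued map is compactly measurable if it has nonempty compact values and the set of
points whose value meets a given compact set is always measurable. -/
structure CompactlyMeasurable [TopologicalSpace E] (A : α → Set E) : Prop where
  nonempty : ∀ a, (A a).Nonempty
  isCompact : ∀ a, IsCompact (A a)
  measurableSet_inter : ∀ K, IsCompact K → MeasurableSet {a | (A a ∩ K).Nonempty}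

/-- The composition of a closed set-valued map having nonempty compact values with a measurable
map is compactly measurable. -/
lemma CompactlyMeasurable.of_closed_comp [TopologicalSpace E] [FirstCountableTopology E] {T : Type*} [MetricSpace T] [MeasurableSpace T]
    [BorelSpace T] {S : T → Set E} (hne : ∀ t, (S t).Nonempty) (hcp : ∀ t, IsCompact (S t))
    (hcl : ∀ (xs : ℕ → E) (ts : ℕ → T) (x : E) (t : T),
      Filter.Tendsto xs Filter.atTop (nhds x) → Filter.Tendsto ts Filter.atTop (nhds t) →
      (∀ k, xs k ∈ S (ts k)) → x ∈ S t)
    {Z : α → T} (hZ : Measurable Z) : CompactlyMeasurable fun a => S (Z a) := by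
  refine ⟨fun a => hne _, fun a => hcp _, fun K hK => ?_⟩
  have : IsClosed {t | (S t ∩ K).Nonempty} := by
    refine IsSeqClosed.isClosed fun ts t hts hlim => ?_
    choose xs hxs using hts
    obtain ⟨x, hx, φ, hφ, hxlim⟩ := hK.tendsto_subseq fun n => (hxs n).2
    exact ⟨x, hcl (xs ∘ φ) (ts ∘ φ) x t hxlim (hlim.comp hφ.tendsto_atTop)
      fun k => (hxs (φ k)).1, hx⟩
  exact hZ this.measurableSet

variable [MetricSpace E] [ProperSpace E]

lemma CompactlyMeasurable.measurableSet_exists_le {A : α → Set E} (hA : CompactlyMeasurable A)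
    {h : α → E → ℝ} (hm : ∀ x, Measurable fun a => h a x) (hc : ∀ a, Continuous (h a))
    {K : Set E} (hK : IsCompact K) (c : ℝ) :
    MeasurableSet {a | ∃ x ∈ A a ∩ K, h a x ≤ c} := by
  obtain ⟨D, hDc, hD⟩ := TopologicalSpace.exists_countable_dense E
  have key : {a | ∃ x ∈ A a ∩ K, h a x ≤ c} =
      ⋂ n : ℕ, ⋃ q ∈ D, {a | h a q < c + 1 / ((n : ℝ) + 1)} ∩
        {a | (A a ∩ (K ∩ Metric.closedBall q (1 / ((n : ℝ) + 1)))).Nonempty} := by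
    ext a
    simp only [Set.mem_ofPred_eq, Set.mem_iInter, Set.mem_iUnion, Set.mem_inter_iff, exists_prop]
    constructor
    · rintro ⟨x, ⟨hxA, hxK⟩, hx⟩ n
      have hn : (0 : ℝ) < 1 / ((n : ℝ) + 1) := by positivity
      have hU : IsOpen ({q | h a q < c + 1 / ((n : ℝ) + 1)} ∩
          Metric.ball x (1 / ((n : ℝ) + 1))) :=
        (isOpen_lt (hc a) continuous_const).inter Metric.isOpen_ball
      obtain ⟨q, hqU, hqD⟩ := hD.inter_open_nonempty _ hU
        ⟨x, by simp only [Set.mem_ofPred_eq]; linarith, Metric.mem_ball_self hn⟩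
      refine ⟨q, hqD, hqU.1, x, hxA, hxK, ?_⟩
      rw [Metric.mem_closedBall, dist_comm]
      exact (Metric.mem_ball.1 hqU.2).le
    · intro H
      choose q _ hq x hxA hxK hxq using H
      obtain ⟨z, hz, φ, hφ, hlim⟩ :=
        ((hA.isCompact a).inter hK).tendsto_subseq (x := x) fun n => ⟨hxA n, hxK n⟩
      have h0 : Filter.Tendsto (fun n => 1 / ((φ n : ℝ) + 1)) Filter.atTop (nhds 0) :=
        tendsto_one_div_add_atTop_nhds_zero_nat.comp hφ.tendsto_atTop
      have hqz : Filter.Tendsto (q ∘ φ) Filter.atTop (nhds z) := by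
        refine (tendsto_iff_of_dist ?_).1 hlim
        exact squeeze_zero (fun _ => dist_nonneg) (fun n => Metric.mem_closedBall.1 (hxq (φ n))) h0
      refine ⟨z, hz, ?_⟩
      have h1 := ((hc a).tendsto z).comp hqz
      have h2 := h0.const_add c
      rw [add_zero] at h2
      exact le_of_tendsto_of_tendsto' h1 h2 fun n => (hq (φ n)).le
  rw [key]
  refine MeasurableSet.iInter fun n => MeasurableSet.biUnion hDc fun q _ => ?_
  exact (measurableSet_lt (hm q) measurable_const).inter
    (hA.measurableSet_inter _ (hK.inter_right Metric.isClosed_closedBall))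

lemma CompactlyMeasurable.argmin [Nonempty E] {A : α → Set E} (hA : CompactlyMeasurable A)
    {h : α → E → ℝ} (hm : ∀ x, Measurable fun a => h a x) (hc : ∀ a, Continuous (h a)) :
    CompactlyMeasurable fun a => {x ∈ A a | ∀ y ∈ A a, h a x ≤ h a y} := by
  refine ⟨fun a => ?_, fun a => ?_, fun K hK => ?_⟩
  · obtain ⟨x, hx, hmin⟩ := (hA.isCompact a).exists_isMinOn (hA.nonempty a) (hc a).continuousOn
    exact ⟨x, hx, fun y hy => hmin hy⟩
  · refine (hA.isCompact a).of_isClosed_subset ?_ fun x hx => hx.1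
    have : {x ∈ A a | ∀ y ∈ A a, h a x ≤ h a y} = A a ∩ ⋂ y ∈ A a, {x | h a x ≤ h a y} := by
      ext x; simp
    rw [this]
    exact (hA.isCompact a).isClosed.inter
      (isClosed_biInter fun y _ => isClosed_le (hc a) continuous_const)
  · let p : E := Classical.arbitrary E
    have key : {a | ({x ∈ A a | ∀ y ∈ A a, h a x ≤ h a y} ∩ K).Nonempty} =
        ⋂ c : ℚ, (⋃ n : ℕ, {a | ∃ x ∈ A a ∩ Metric.closedBall p n, h a x ≤ c})ᶜ ∪
          {a | ∃ x ∈ A a ∩ K, h a x ≤ c} := by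
      ext a
      simp only [Set.mem_iInter, Set.mem_union, Set.mem_compl_iff, ← imp_iff_not_or,
        Set.mem_iUnion, Set.mem_ofPred_eq]
      constructor
      · rintro ⟨x, ⟨hxA, hmin⟩, hxK⟩ c ⟨n, y, ⟨hy, _⟩, hyc⟩
        exact ⟨x, ⟨hxA, hxK⟩, (hmin y hy).trans hyc⟩
      · intro H
        have H' : ∀ y ∈ A a, ∀ c : ℚ, h a y < c → ∃ x ∈ A a ∩ K, h a x ≤ c := by
          intro y hy c hyc
          obtain ⟨n, hn⟩ := exists_nat_ge (dist y p)
          exact H c ⟨n, y, ⟨hy, Metric.mem_closedBall.2 hn⟩, hyc.le⟩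
        obtain ⟨y₀, hy₀⟩ := hA.nonempty a
        obtain ⟨c₀, hc₀⟩ := exists_rat_gt (h a y₀)
        obtain ⟨x₀, hx₀, _⟩ := H' y₀ hy₀ c₀ hc₀
        obtain ⟨x, hx, hmin⟩ := ((hA.isCompact a).inter hK).exists_isMinOn ⟨x₀, hx₀⟩
          (hc a).continuousOn
        refine ⟨x, ⟨hx.1, fun y hy => ?_⟩, hx.2⟩
        by_contra! hlt
        obtain ⟨c, hc1, hc2⟩ := exists_rat_btwn hlt
        obtain ⟨w, hw, hwc⟩ := H' y hy c hc1
        exact absurd ((isMinOn_iff.1 hmin w hw).trans hwc) hc2.not_ge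
    rw [key]
    exact MeasurableSet.iInter fun c : ℚ => (MeasurableSet.iUnion fun n : ℕ =>
      hA.measurableSet_exists_le hm hc (isCompact_closedBall p n) c).compl.union
      (hA.measurableSet_exists_le hm hc hK c)

lemma measurable_of_preimage_isCompact [Nonempty E] [MeasurableSpace E] [BorelSpace E] {X : α → E}
    (hX : ∀ K, IsCompact K → MeasurableSet (X ⁻¹' K)) : Measurable X := by
  refine measurable_of_isClosed fun C hC => ?_
  let p : E := Classical.arbitrary E
  have : X ⁻¹' C = ⋃ n : ℕ, X ⁻¹' (Metric.closedBall p n ∩ C) := by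
    rw [← Set.preimage_iUnion, ← Set.iUnion_inter, Metric.iUnion_closedBall_nat, Set.univ_inter]
  rw [this]
  exact MeasurableSet.iUnion fun n => hX _ ((isCompact_closedBall p n).inter_right hC)

/-- Measurable selection, by successive minimization of the coordinates. -/
lemma CompactlyMeasurable.exists_measurable_selection {ι : Type*} [Fintype ι]
    {A : α → Set (ι → ℝ)} (hA : CompactlyMeasurable A) :
    ∃ X : α → ι → ℝ, Measurable X ∧ ∀ a, X a ∈ A a := by
  classical
  have lex : ∀ s : Finset ι, ∃ B : α → Set (ι → ℝ), CompactlyMeasurable B ∧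
      (∀ a, B a ⊆ A a) ∧ ∀ a, ∀ x ∈ B a, ∀ y ∈ B a, ∀ i ∈ s, x i = y i := by
    intro s
    induction s using Finset.induction_on with
    | empty => exact ⟨A, hA, fun _ => subset_rfl, by simp⟩
    | insert j s _ ih =>
      obtain ⟨B, hB, hBA, hBs⟩ := ih
      refine ⟨_, hB.argmin (h := fun _ x => x j) (fun _ => measurable_const)
        (fun _ => continuous_apply j), fun a x hx => hBA a hx.1, ?_⟩
      rintro a x ⟨hx, hxmin⟩ y ⟨hy, hymin⟩ i hi
      rcases Finset.mem_insert.1 hi with rfl | hi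
      · exact le_antisymm (hxmin y hy) (hymin x hx)
      · exact hBs a x hx y hy i hi
  obtain ⟨B, hB, hBA, hBs⟩ := lex Finset.univ
  choose X hX using hB.nonempty
  refine ⟨X, measurable_of_preimage_isCompact fun K hK => ?_, fun a => hBA a (hX a)⟩
  convert hB.measurableSet_inter K hK using 1
  ext a
  refine ⟨fun h => ⟨X a, hX a, h⟩, ?_⟩
  rintro ⟨x, hx, hxK⟩
  have : X a = x := funext fun i => hBs a _ (hX a) _ hx i (Finset.mem_univ i)
  simpa [this] using hxK

end MeasurableSelection

section Substitution

variable {Ω E : Type*} {m m0 : MeasurableSpace Ω} {P : Measure Ω}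
  {g : Ω → E → ℝ} {ψ : Ω → ℝ}

lemma ae_forall_abs_condExp_le [TopologicalSpace E] [TopologicalSpace.SeparableSpace E]
    (hint : ∀ x, Integrable (fun ω => g ω x) P) (hψ : Integrable ψ P)
    (hdom : ∀ ω x, |g ω x| ≤ ψ ω)
    (hcond : ∀ ω, Continuous fun x => (P[fun ω' => g ω' x | m]) ω) :
    ∀ᵐ ω ∂P, ∀ x, |(P[fun ω' => g ω' x | m]) ω| ≤ (P[ψ | m]) ω := by
  obtain ⟨D, hDc, hD⟩ := TopologicalSpace.exists_countable_dense E
  have h : ∀ᵐ ω ∂P, ∀ x ∈ D, |(P[fun ω' => g ω' x | m]) ω| ≤ (P[ψ | m]) ω := by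
    rw [ae_ball_iff hDc]
    intro x _
    have h1 := condExp_mono (m := m) (hint x) hψ
      (Filter.Eventually.of_forall fun ω => (abs_le.1 (hdom ω x)).2)
    have h2 := condExp_mono (m := m) hψ.neg (hint x)
      (Filter.Eventually.of_forall fun ω => (abs_le.1 (hdom ω x)).1)
    filter_upwards [h1, h2, condExp_neg ψ m (μ := P)] with ω h1 h2 h3
    rw [h3] at h2
    exact abs_le.2 ⟨h2, h1⟩
  filter_upwards [h] with ω hω x
  have hcl : IsClosed {x | |(P[fun ω' => g ω' x | m]) ω| ≤ (P[ψ | m]) ω} :=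
    isClosed_le (hcond ω).abs continuous_const
  exact hcl.closure_subset_iff.2 hω (hD x)

lemma integral_finite_range_substitution_condExp [IsFiniteMeasure P] (hm : m ≤ m0)
    (hint : ∀ x, Integrable (fun ω => g ω x) P) {f : Ω → E} {R : Finset E} (hR : ∀ ω, f ω ∈ R)
    (hs : ∀ x, MeasurableSet[m] (f ⁻¹' {x})) :
    ∫ ω, g ω (f ω) ∂P = ∫ ω, (P[fun ω' => g ω' (f ω) | m]) ω ∂P := by
  classical
  have expand : ∀ k : Ω → E → ℝ, (∀ x, Integrable (fun ω => k ω x) P) →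
      ∫ ω, k ω (f ω) ∂P = ∑ x ∈ R, ∫ ω in f ⁻¹' {x}, k ω x ∂P := by
    intro k hk
    have : (fun ω => k ω (f ω)) =
        fun ω => ∑ x ∈ R, (f ⁻¹' {x}).indicator (fun ω => k ω x) ω := by
      ext ω
      rw [Finset.sum_eq_single (f ω)]
      · simp
      · intro x _ hx
        exact Set.indicator_of_notMem (fun h => hx h.symm) _
      · exact fun h => (h (hR ω)).elim
    rw [this, integral_finsetSum _ fun x _ => (hk x).indicator (hm _ (hs x))]
    exact Finset.sum_congr rfl fun x _ => integral_indicator (hm _ (hs x))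
  rw [expand g hint, expand (fun ω x => (P[fun ω' => g ω' x | m]) ω) fun x => integrable_condExp]
  exact Finset.sum_congr rfl fun x _ => (setIntegral_condExp hm (hint x) (hs x)).symm

/-- Substitution of a measurable policy into a conditional expectation depending continuously on
a parameter. -/
lemma integral_substitution_condExp [IsFiniteMeasure P] [TopologicalSpace E]
    [TopologicalSpace.SeparableSpace E]
    (hm : m ≤ m0) (hgm : ∀ x, Measurable[m0] fun ω => g ω x) (hgc : ∀ ω, Continuous (g ω))
    (hψ : Integrable ψ P) (hdom : ∀ ω x, |g ω x| ≤ ψ ω)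
    (hcond : ∀ ω, Continuous fun x => (P[fun ω' => g ω' x | m]) ω)
    {X : Ω → E} (hX : StronglyMeasurable[m] X) :
    Integrable (fun ω => (P[fun ω' => g ω' (X ω) | m]) ω) P ∧
      ∫ ω, g ω (X ω) ∂P = ∫ ω, (P[fun ω' => g ω' (X ω) | m]) ω ∂P := by
  have hint : ∀ x, Integrable (fun ω => g ω x) P := fun x =>
    hψ.mono' (hgm x).aestronglyMeasurable (Filter.Eventually.of_forall fun ω => hdom ω x)
  have hbound := ae_forall_abs_condExp_le hint hψ hdom hcond
  let R : ℕ → Finset E := fun n => @SimpleFunc.range Ω E m (hX.approx n)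
  have hR : ∀ n ω, hX.approx n ω ∈ R n := fun n => @SimpleFunc.mem_range_self Ω E m (hX.approx n)
  have hs : ∀ n x, MeasurableSet[m] (hX.approx n ⁻¹' {x}) := fun n =>
    @SimpleFunc.measurableSet_fiber Ω E m (hX.approx n)
  have meas : ∀ (k : Ω → E → ℝ), (∀ x, Measurable[m0] fun ω => k ω x) → ∀ n,
      Measurable[m0] fun ω => k ω (hX.approx n ω) := by
    intro k hk n s hsm
    have : (fun ω => k ω (hX.approx n ω)) ⁻¹' s =
        ⋃ x ∈ R n, hX.approx n ⁻¹' {x} ∩ (fun ω => k ω x) ⁻¹' s := by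
      ext ω; simpa using fun _ => hR n ω
    rw [this]
    exact Finset.measurableSet_biUnion _ fun x _ =>
      (hm _ (hs n x)).inter (hk x hsm)
  have hcm : ∀ x, Measurable[m0] fun ω => (P[fun ω' => g ω' x | m]) ω := fun x =>
    (stronglyMeasurable_condExp.mono hm).measurable
  have lim1 : ∀ ω, Filter.Tendsto (fun n => g ω (hX.approx n ω)) Filter.atTop (nhds (g ω (X ω))) :=
    fun ω => ((hgc ω).tendsto _).comp (hX.tendsto_approx ω)
  have lim2 : ∀ ω, Filter.Tendsto (fun n => (P[fun ω' => g ω' (hX.approx n ω) | m]) ω)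
      Filter.atTop (nhds ((P[fun ω' => g ω' (X ω) | m]) ω)) :=
    fun ω => ((hcond ω).tendsto _).comp (hX.tendsto_approx ω)
  have mlim : Measurable[m0] fun ω => (P[fun ω' => g ω' (X ω) | m]) ω :=
    measurable_of_tendsto_metrizable
      (meas (fun ω x => (P[fun ω' => g ω' x | m]) ω) hcm)
      (tendsto_pi_nhds.2 lim2)
  refine ⟨(integrable_condExp (m := m) (f := ψ)).mono' mlim.aestronglyMeasurable
    (hbound.mono fun ω h => h _), ?_⟩
  have t1 := tendsto_integral_of_dominated_convergence (μ := P) ψ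
    (fun n => (meas g hgm n).aestronglyMeasurable) hψ
    (fun n => Filter.Eventually.of_forall fun ω => hdom ω _)
    (Filter.Eventually.of_forall lim1)
  have t2 := tendsto_integral_of_dominated_convergence (μ := P) (P[ψ | m])
    (fun n => (meas (fun ω x => (P[fun ω' => g ω' x | m]) ω) hcm
      n).aestronglyMeasurable) integrable_condExp
    (fun n => hbound.mono fun ω h => h _)
    (Filter.Eventually.of_forall lim2)
  refine tendsto_nhds_unique t1 ?_
  convert t2 using 2 with n
  exact integral_finite_range_substitution_condExp hm hint (hR n) (hs n)

end Substitution


/-- Fundamental Lemma of Stochastic Control (fused version, conditions C1–C6):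
existence of a `σ(Y)`-measurable optimal policy obtained by pointwise minimization
of the conditional cost over the random constraint set. -/
theorem stmt8 {Ω : Type*} [m0 : MeasurableSpace Ω] (P : Measure Ω) [IsProbabilityMeasure P]
    (M N : ℕ) (Y : Ω → Fin M → ℝ) (hY : Measurable Y)
    -- C1: 𝒳 is a closed multifunction with nonempty compact values
    (𝒳 : (Fin N → ℝ) → Set (Fin N → ℝ))
    (h𝒳ne : ∀ y, (𝒳 y).Nonempty) (h𝒳cp : ∀ y, IsCompact (𝒳 y))
    (h𝒳closed : ∀ (xs ys : ℕ → Fin N → ℝ) (x y : Fin N → ℝ),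
      Filter.Tendsto xs Filter.atTop (nhds x) → Filter.Tendsto ys Filter.atTop (nhds y) →
      (∀ k, xs k ∈ 𝒳 (ys k)) → x ∈ 𝒳 y)
    -- C2: Z is Borel measurable, so Z ∘ Y is σ(Y)-measurable
    (Z : (Fin M → ℝ) → Fin N → ℝ) (hZ : Measurable Z)
    (g : Ω → (Fin N → ℝ) → ℝ)
    -- decision set of σ(Y)-measurable a.e. selections
    (F : Set (Ω → Fin N → ℝ))
    (hF : F = {X | Measurable[MeasurableSpace.comap Y inferInstance] X ∧
      ∀ᵐ ω ∂P, X ω ∈ 𝒳 (Z (Y ω))})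
    -- C3: integrability of the cost along every admissible policy
    (hFint : ∀ X ∈ F, Integrable (fun ω => g ω (X ω)) P)
    -- C4: uniform integrable domination
    (ψ : Ω → ℝ) (hψ : Integrable ψ P) (hdom : ∀ ω x, |g ω x| ≤ ψ ω)
    -- C5: g is Carathéodory
    (hmeas : ∀ x, Measurable fun ω => g ω x)
    (hcont : ∀ ω, Continuous fun x => g ω x)
    -- C6: the conditional expectation is Carathéodory
    (hcondcont : ∀ ω, Continuous fun x =>
      (P[fun ω' => g ω' x | MeasurableSpace.comap Y inferInstance]) ω) :
    ∃ Xstar : Ω → Fin N → ℝ,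
      Measurable[MeasurableSpace.comap Y inferInstance] Xstar ∧
      (∀ ω, Xstar ω ∈ 𝒳 (Z (Y ω))) ∧
      (∀ ω, ∀ x ∈ 𝒳 (Z (Y ω)),
        (P[fun ω' => g ω' (Xstar ω) | MeasurableSpace.comap Y inferInstance]) ω ≤
        (P[fun ω' => g ω' x | MeasurableSpace.comap Y inferInstance]) ω) ∧
      ∀ X ∈ F, ∫ ω, g ω (Xstar ω) ∂P ≤ ∫ ω, g ω (X ω) ∂P := by
  have hm : MeasurableSpace.comap Y inferInstance ≤ m0 := hY.comap_le
  have hZY : Measurable[MeasurableSpace.comap Y inferInstance] fun ω => Z (Y ω) :=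
    hZ.comp (comap_measurable Y)
  have hA := @CompactlyMeasurable.of_closed_comp Ω (Fin N → ℝ)
    (MeasurableSpace.comap Y inferInstance) _ _ _ _ _ _ 𝒳 h𝒳ne h𝒳cp h𝒳closed _ hZY
  have hB := @CompactlyMeasurable.argmin Ω (Fin N → ℝ)
    (MeasurableSpace.comap Y inferInstance) _ _ _ _ hA (fun ω x =>
    (P[fun ω' => g ω' x | MeasurableSpace.comap Y inferInstance]) ω)
    (fun x => stronglyMeasurable_condExp.measurable) hcondcont
  obtain ⟨X, hXm, hX⟩ := @CompactlyMeasurable.exists_measurable_selection Ω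
    (MeasurableSpace.comap Y inferInstance) _ _ _ hB
  refine ⟨X, hXm, fun ω => (hX ω).1, fun ω => (hX ω).2, fun X' hX' => ?_⟩
  rw [hF] at hX'
  have sub := fun {W : Ω → Fin N → ℝ} =>
    integral_substitution_condExp hm hmeas hcont hψ hdom hcondcont (X := W)
  obtain ⟨i1, e1⟩ := sub hXm.stronglyMeasurable
  obtain ⟨i2, e2⟩ := sub hX'.1.stronglyMeasurable
  rw [e1, e2]
  refine integral_mono_ae i1 i2 ?_
  filter_upwards [hX'.2] with ω hω
  exact (hX ω).2 _ hω
end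

section
/- Let ε > 0 and set c := max{ (log ε)², 6·e^{−2}/ε }. Then for every τ ∈ (0, 1), the spherical covariance kernel deficiency satisfies: (if τ < ε then (3/2)·(τ/ε) − (1/2)·(τ/ε)³ else 1) ≤ c / (log τ)². Equivalently, with Σ_o(τ)/σ² := (1 − (3/2)(τ/ε) + (1/2)(τ/ε)³)·1{τ < ε}, one has 1 − Σ_o(τ)/Σ_o(0) ≤ c/(log τ)² for all τ ∈ (0, 1); in the course of the proof, τ·(log τ)² ≤ 4·e^{−2} for all τ ∈ (0, 1). -/
open Real

/-- On `(0, 1]` the function `x * (log x) ^ 2` is at most its value `4e⁻²` at `x = e⁻²`. -/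
theorem Real.mul_log_sq_le_four_mul_exp_neg_two {x : ℝ} (hx : 0 < x) (hx1 : x ≤ 1) :
    x * Real.log x ^ 2 ≤ 4 * Real.exp (-2) := by
  have hlog : Real.log x ≤ 0 := Real.log_nonpos hx.le hx1
  have hle : -Real.log x / 2 ≤ Real.exp (-Real.log x / 2 - 1) := by
    linarith [Real.add_one_le_exp (-Real.log x / 2 - 1)]
  have hsq : (-Real.log x / 2) ^ 2 ≤ Real.exp (-Real.log x / 2 - 1) ^ 2 :=
    pow_le_pow_left₀ (by linarith) hle 2
  have hexp : x * Real.exp (-Real.log x / 2 - 1) ^ 2 = Real.exp (-2) := by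
    nth_rewrite 1 [← Real.exp_log hx]
    rw [← Real.exp_nat_mul, ← Real.exp_add]
    congr 1
    push_cast
    ring
  linarith [mul_le_mul_of_nonneg_left hsq hx.le]

/-- The spherical covariance kernel of width ε satisfies the logarithmic
continuity criterion: `1 − Σ_o(τ)/Σ_o(0) ≤ c/(log τ)²` on (0,1), with
`c = max{(log ε)², 6e⁻²/ε}`; moreover `τ·(log τ)² ≤ 4e⁻²` on (0,1). -/
theorem stmt13 (ε : ℝ) (hε : 0 < ε)
    (c : ℝ) (hc : c = max ((Real.log ε) ^ 2) (6 * Real.exp (-2) / ε)) :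
    ∀ τ : ℝ, τ ∈ Set.Ioo (0 : ℝ) 1 →
      ((if τ < ε then (3 / 2) * (τ / ε) - (1 / 2) * (τ / ε) ^ 3 else 1)
        ≤ c / (Real.log τ) ^ 2) ∧
      τ * (Real.log τ) ^ 2 ≤ 4 * Real.exp (-2) := by
  rintro τ ⟨hτ, hτ1⟩
  have hbound := Real.mul_log_sq_le_four_mul_exp_neg_two hτ hτ1.le
  have hlog : Real.log τ < 0 := Real.log_neg hτ hτ1
  refine ⟨?_, hbound⟩
  rw [le_div_iff₀ (sq_pos_of_neg hlog), hc]
  split_ifs with h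
  · refine le_trans ?_ (le_max_right _ _)
    calc (3 / 2 * (τ / ε) - 1 / 2 * (τ / ε) ^ 3) * Real.log τ ^ 2
        ≤ 3 / 2 * (τ / ε) * Real.log τ ^ 2 := by
          gcongr
          exact sub_le_self _ (by positivity)
      _ = 3 / 2 * (τ * Real.log τ ^ 2) / ε := by ring
      _ ≤ 3 / 2 * (4 * Real.exp (-2)) / ε := by gcongr
      _ = 6 * Real.exp (-2) / ε := by ring
  · refine le_trans ?_ (le_max_left _ _)
    have hle : Real.log ε ≤ Real.log τ := Real.log_le_log hε (not_lt.mp h)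
    nlinarith
end
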